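/- arXiv:1609.00672 — 10 statements merged into one kernel-verified Lean document; each statement's English description precedes it below -/
import Mathlib

section
/- For every probability distribution P on six {0,1}-valued variables (A₁,A₂,B₁,B₂,C₁,C₂), i.e., every nonnegative function on ({0,1})^6 summing to 1, the marginal probabilities satisfy P_{A₂B₂C₂}(1,1,1) ≤ P_{A₁B₂C₂}(1,1,1) + P_{A₂B₁C₂}(1,1,1) + P_{A₂B₂C₁}(1,1,1) + P_{A₁B₁C₁}(0,0,0), where each marginal is obtained from P by summing out the remaining three variables. -/
open scoped BigOperators

/-- For every probability distribution `P` on six binary variables `(A₁,A₂,B₁,B₂,C₁,C₂)`,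
the marginal probabilities satisfy
`P_{A₂B₂C₂}(1,1,1) ≤ P_{A₁B₂C₂}(1,1,1) + P_{A₂B₁C₂}(1,1,1) + P_{A₂B₂C₁}(1,1,1) + P_{A₁B₁C₁}(0,0,0)`. -/
theorem marginal_inequality_six_binary
    (P : Fin 2 → Fin 2 → Fin 2 → Fin 2 → Fin 2 → Fin 2 → ℝ)
    (hP0 : ∀ a₁ a₂ b₁ b₂ c₁ c₂, 0 ≤ P a₁ a₂ b₁ b₂ c₁ c₂)
    (hP1 : ∑ a₁, ∑ a₂, ∑ b₁, ∑ b₂, ∑ c₁, ∑ c₂, P a₁ a₂ b₁ b₂ c₁ c₂ = 1) :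
    (∑ a₁, ∑ b₁, ∑ c₁, P a₁ 1 b₁ 1 c₁ 1) ≤
      (∑ a₂, ∑ b₁, ∑ c₁, P 1 a₂ b₁ 1 c₁ 1)
        + (∑ a₁, ∑ b₂, ∑ c₁, P a₁ 1 1 b₂ c₁ 1)
        + (∑ a₁, ∑ b₁, ∑ c₂, P a₁ 1 b₁ 1 1 c₂)
        + (∑ a₂, ∑ b₂, ∑ c₂, P 0 a₂ 0 b₂ 0 c₂) := by
  simp only [Fin.forall_fin_two] at hP0
  simp only [Fin.sum_univ_two]
  cases_type* And
  linarith
end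

section
/- If a probability distribution P on ({-1,1})^3 is compatible with the Triangle scenario, then its correlators satisfy ⟨AC⟩ + ⟨BC⟩ ≤ 1 + ⟨A⟩·⟨B⟩, where ⟨A⟩ := Σ_{a,b,c} a·P(a,b,c), ⟨B⟩ := Σ_{a,b,c} b·P(a,b,c), ⟨AC⟩ := Σ_{a,b,c} a·c·P(a,b,c), and ⟨BC⟩ := Σ_{a,b,c} b·c·P(a,b,c). -/
open scoped BigOperators NNReal

/-- The two-element set of outcomes `{-1, 1}` inside the reals. -/
noncomputable def pm : Finset ℝ := {-1, 1}

/-- The expectation, under a distribution `P` on `{-1,1}³`, of a function `f` of the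
three coordinates. -/
noncomputable def corr (f : ℝ → ℝ → ℝ → ℝ) (P : ℝ → ℝ → ℝ → ℝ) : ℝ :=
  ∑ a ∈ pm, ∑ b ∈ pm, ∑ c ∈ pm, f a b c * P a b c

/-- Compatibility of a distribution on `{-1,1}³` with the Triangle causal scenario:
there are latent variables `X`, `Y`, `Z` with probability mass functions, and conditional
distributions for each observed node given its two latent parents, reproducing `P`. -/
def TriangleCompatible (P : ℝ → ℝ → ℝ → ℝ) : Prop :=
  ∃ (X Y Z : Type) (μX : X → ℝ≥0) (μY : Y → ℝ≥0) (μZ : Z → ℝ≥0)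
    (qA : Y × Z → ℝ → ℝ≥0) (qB : X × Z → ℝ → ℝ≥0) (qC : X × Y → ℝ → ℝ≥0),
    (∑' x, μX x) = 1 ∧ (∑' y, μY y) = 1 ∧ (∑' z, μZ z) = 1 ∧
    (∀ yz, qA yz (-1) + qA yz 1 = 1) ∧
    (∀ xz, qB xz (-1) + qB xz 1 = 1) ∧
    (∀ xy, qC xy (-1) + qC xy 1 = 1) ∧
    ∀ a b c, P a b c =
      ((∑' (x : X) (y : Y) (z : Z),
        μX x * μY y * μZ z * qA (y, z) a * qB (x, z) b * qC (x, y) c : ℝ≥0) : ℝ)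

open scoped ENNReal

/-- For independent `{-1, 1}`-valued variables, `A ≠ B` forces `A ≠ C` or `B ≠ C`. -/
lemma disagreement_le {a a' b b' c c' : ℝ≥0∞} (ha : a + a' = 1) (hb : b + b' = 1)
    (hc : c + c' = 1) :
    a * b' + a' * b ≤ (a * c' + a' * c) + (b * c' + b' * c) := by
  have le_left {u v : ℝ≥0∞} (h : u + v = 1) : u ≤ 1 := h ▸ le_self_add
  have le_right {u v : ℝ≥0∞} (h : u + v = 1) : v ≤ 1 := h ▸ le_add_self
  calc a * b' + a' * b = (a * b' + a' * b) * (c + c') := by rw [hc, mul_one]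
    _ = (b' * (a * c') + b * (a' * c)) + (a' * (b * c') + a * (b' * c)) := by ring
    _ ≤ (1 * (a * c') + 1 * (a' * c)) + (1 * (b * c') + 1 * (b' * c)) := by
      gcongr
      exacts [le_right hb, le_left hb, le_right ha, le_left ha]
    _ = _ := by simp only [one_mul]

section Triangle

variable {X Y Z : Type} {μX : X → ℝ≥0∞} {μY : Y → ℝ≥0∞} {μZ : Z → ℝ≥0∞}

/-- The mass of a product of response functions in the Triangle scenario. -/
noncomputable def triangleMass (μX : X → ℝ≥0∞) (μY : Y → ℝ≥0∞) (μZ : Z → ℝ≥0∞)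
    (f : Y × Z → ℝ≥0∞) (g : X × Z → ℝ≥0∞) (h : X × Y → ℝ≥0∞) : ℝ≥0∞ :=
  ∑' (x : X) (y : Y) (z : Z), μX x * μY y * μZ z * f (y, z) * g (x, z) * h (x, y)

lemma triangleMass_add_left (f f' : Y × Z → ℝ≥0∞) (g : X × Z → ℝ≥0∞) (h : X × Y → ℝ≥0∞) :
    triangleMass μX μY μZ f g h + triangleMass μX μY μZ f' g h =
      triangleMass μX μY μZ (f + f') g h := by
  simp only [triangleMass, ← ENNReal.tsum_add, Pi.add_apply, mul_add, add_mul]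

lemma triangleMass_add_middle (f : Y × Z → ℝ≥0∞) (g g' : X × Z → ℝ≥0∞) (h : X × Y → ℝ≥0∞) :
    triangleMass μX μY μZ f g h + triangleMass μX μY μZ f g' h =
      triangleMass μX μY μZ f (g + g') h := by
  simp only [triangleMass, ← ENNReal.tsum_add, Pi.add_apply, mul_add, add_mul]

lemma triangleMass_add_right (f : Y × Z → ℝ≥0∞) (g : X × Z → ℝ≥0∞) (h h' : X × Y → ℝ≥0∞) :
    triangleMass μX μY μZ f g h + triangleMass μX μY μZ f g h' =
      triangleMass μX μY μZ f g (h + h') := by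
  simp only [triangleMass, ← ENNReal.tsum_add, Pi.add_apply, mul_add]

lemma triangleMass_one_middle (f : Y × Z → ℝ≥0∞) (h : X × Y → ℝ≥0∞) :
    triangleMass μX μY μZ f 1 h =
      ∑' (x : X) (y : Y), μX x * μY y * ((∑' z, μZ z * f (y, z)) * h (x, y)) := by
  simp only [triangleMass, ← ENNReal.tsum_mul_left, ← ENNReal.tsum_mul_right, Pi.one_apply,
    mul_one, mul_assoc]

lemma triangleMass_one_left (g : X × Z → ℝ≥0∞) (h : X × Y → ℝ≥0∞) :
    triangleMass μX μY μZ 1 g h =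
      ∑' (x : X) (y : Y), μX x * μY y * ((∑' z, μZ z * g (x, z)) * h (x, y)) := by
  simp only [triangleMass, ← ENNReal.tsum_mul_left, ← ENNReal.tsum_mul_right, Pi.one_apply,
    mul_one, mul_assoc]

/-- The first and second observed variables are independent once the source they share is
replaced by two independent copies. -/
lemma triangleMass_mul (hX : ∑' x, μX x = 1) (hY : ∑' y, μY y = 1)
    (f : Y × Z → ℝ≥0∞) (g : X × Z → ℝ≥0∞) :
    triangleMass μX μY μZ f 1 1 * triangleMass μX μY μZ 1 g 1 =
      ∑' (x : X) (y : Y),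
        μX x * μY y * ((∑' z, μZ z * f (y, z)) * (∑' z, μZ z * g (x, z))) := by
  have hf : triangleMass μX μY μZ f 1 1 = ∑' y, μY y * ∑' z, μZ z * f (y, z) := by
    simp only [triangleMass_one_middle, Pi.one_apply, mul_one, mul_assoc, ENNReal.tsum_mul_left,
      ENNReal.tsum_mul_right, hX, one_mul]
  have hg : triangleMass μX μY μZ 1 g 1 = ∑' x, μX x * ∑' z, μZ z * g (x, z) := by
    simp only [triangleMass_one_left, Pi.one_apply, mul_one, mul_assoc, ENNReal.tsum_mul_left,
      ENNReal.tsum_mul_right, hY, one_mul]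
  rw [hf, hg, mul_comm, ← ENNReal.tsum_mul_right]
  refine tsum_congr fun x => ?_
  rw [← ENNReal.tsum_mul_left]
  exact tsum_congr fun y => by ring

lemma triangleMass_ne_top (hX : ∑' x, μX x = 1) (hY : ∑' y, μY y = 1) (hZ : ∑' z, μZ z = 1)
    {f : Y × Z → ℝ≥0∞} {g : X × Z → ℝ≥0∞} {h : X × Y → ℝ≥0∞}
    (hf : f ≤ 1) (hg : g ≤ 1) (hh : h ≤ 1) : triangleMass μX μY μZ f g h ≠ ∞ := by
  have le_mass : triangleMass μX μY μZ f g h ≤ triangleMass μX μY μZ 1 1 1 :=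
    ENNReal.tsum_le_tsum fun x => ENNReal.tsum_le_tsum fun y => ENNReal.tsum_le_tsum fun z => by
      gcongr
      exacts [hf _, hg _, hh _]
  have mass_one : triangleMass μX μY μZ 1 1 1 = 1 := by
    simp only [triangleMass, Pi.one_apply, mul_one, ENNReal.tsum_mul_left, hX, hY, hZ]
  exact ne_top_of_le_ne_top ENNReal.one_ne_top (le_mass.trans_eq mass_one)

/-- The monogamy inequality in terms of probabilities of disagreement. -/
lemma triangleMass_disagreement_le (hX : ∑' x, μX x = 1) (hY : ∑' y, μY y = 1)
    (hZ : ∑' z, μZ z = 1) {f f' : Y × Z → ℝ≥0∞} {g g' : X × Z → ℝ≥0∞} {h h' : X × Y → ℝ≥0∞}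
    (hf : f + f' = 1) (hg : g + g' = 1) (hh : h + h' = 1) :
    triangleMass μX μY μZ f 1 1 * triangleMass μX μY μZ 1 g' 1 +
        triangleMass μX μY μZ f' 1 1 * triangleMass μX μY μZ 1 g 1 ≤
      (triangleMass μX μY μZ f 1 h' + triangleMass μX μY μZ f' 1 h) +
        (triangleMass μX μY μZ 1 g h' + triangleMass μX μY μZ 1 g' h) := by
  simp only [triangleMass_mul hX hY]
  simp only [triangleMass_one_left, triangleMass_one_middle, ← ENNReal.tsum_add, ← mul_add]
  refine ENNReal.tsum_le_tsum fun x => ENNReal.tsum_le_tsum fun y => ?_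
  refine mul_le_mul_right (disagreement_le ?_ ?_ (congrFun hh (x, y))) _
  · rw [← ENNReal.tsum_add, ← hZ]
    refine tsum_congr fun z => ?_
    rw [← mul_add, ← Pi.add_apply, hf, Pi.one_apply, mul_one]
  · rw [← ENNReal.tsum_add, ← hZ]
    refine tsum_congr fun z => ?_
    rw [← mul_add, ← Pi.add_apply, hg, Pi.one_apply, mul_one]

lemma toNNReal_triangleMass {μX : X → ℝ≥0} {μY : Y → ℝ≥0} {μZ : Z → ℝ≥0}
    {f : Y × Z → ℝ≥0} {g : X × Z → ℝ≥0} {h : X × Y → ℝ≥0}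
    (hfin : triangleMass (fun x => (μX x : ℝ≥0∞)) (fun y => (μY y : ℝ≥0∞))
      (fun z => (μZ z : ℝ≥0∞)) (fun p => (f p : ℝ≥0∞)) (fun p => (g p : ℝ≥0∞))
      (fun p => (h p : ℝ≥0∞)) ≠ ∞) :
    (triangleMass (fun x => (μX x : ℝ≥0∞)) (fun y => (μY y : ℝ≥0∞))
      (fun z => (μZ z : ℝ≥0∞)) (fun p => (f p : ℝ≥0∞)) (fun p => (g p : ℝ≥0∞))
      (fun p => (h p : ℝ≥0∞))).toNNReal =
      ∑' (x : X) (y : Y) (z : Z), μX x * μY y * μZ z * f (y, z) * g (x, z) * h (x, y) := by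
  have hx := ENNReal.ne_top_of_tsum_ne_top hfin
  have hy := fun x => ENNReal.ne_top_of_tsum_ne_top (hx x)
  have hz := fun x y => ENNReal.ne_top_of_tsum_ne_top (hy x y)
  rw [triangleMass, ENNReal.tsum_toNNReal_eq hx]
  refine tsum_congr fun x => ?_
  rw [ENNReal.tsum_toNNReal_eq (hy x)]
  refine tsum_congr fun y => ?_
  rw [ENNReal.tsum_toNNReal_eq (hz x y)]
  exact tsum_congr fun z => by simp

end Triangle

lemma tsum_coe_eq_one {ι : Type*} {μ : ι → ℝ≥0} (h : ∑' i, μ i = 1) :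
    ∑' i, (μ i : ℝ≥0∞) = 1 := by
  have hs : Summable μ := by
    by_contra hs
    simp [tsum_eq_zero_of_not_summable hs] at h
  rw [← ENNReal.coe_tsum hs, h, ENNReal.coe_one]

/-- If a probability distribution `P` on `{-1,1}³` is compatible with the Triangle scenario,
then `⟨AC⟩ + ⟨BC⟩ ≤ 1 + ⟨A⟩⟨B⟩`. -/
theorem triangle_monogamy (P : ℝ → ℝ → ℝ → ℝ)
    (hP0 : ∀ a ∈ pm, ∀ b ∈ pm, ∀ c ∈ pm, 0 ≤ P a b c)
    (hP1 : ∑ a ∈ pm, ∑ b ∈ pm, ∑ c ∈ pm, P a b c = 1)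
    (hcomp : TriangleCompatible P) :
    corr (fun a _ c => a * c) P + corr (fun _ b c => b * c) P ≤
      1 + corr (fun a _ _ => a) P * corr (fun _ b _ => b) P := by
  obtain ⟨X, Y, Z, μX, μY, μZ, qA, qB, qC, hX, hY, hZ, hA, hB, hC, hP⟩ := hcomp
  replace hX := tsum_coe_eq_one hX
  replace hY := tsum_coe_eq_one hY
  replace hZ := tsum_coe_eq_one hZ
  let A : ℝ → Y × Z → ℝ≥0∞ := fun a p => qA p a
  let B : ℝ → X × Z → ℝ≥0∞ := fun b p => qB p b
  let C : ℝ → X × Y → ℝ≥0∞ := fun c p => qC p c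
  replace hA : A 1 + A (-1) = 1 := funext fun p => by
    simp only [A, Pi.add_apply, ← ENNReal.coe_add, add_comm (qA p 1), hA, ENNReal.coe_one,
      Pi.one_apply]
  replace hB : B 1 + B (-1) = 1 := funext fun p => by
    simp only [B, Pi.add_apply, ← ENNReal.coe_add, add_comm (qB p 1), hB, ENNReal.coe_one,
      Pi.one_apply]
  replace hC : C 1 + C (-1) = 1 := funext fun p => by
    simp only [C, Pi.add_apply, ← ENNReal.coe_add, add_comm (qC p 1), hC, ENNReal.coe_one,
      Pi.one_apply]
  have le_one {α : Type} {q : ℝ → α → ℝ≥0∞} (hq : q 1 + q (-1) = 1) :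
      ∀ a ∈ pm, q a ≤ 1 := by
    intro a ha
    rcases (by simpa [pm] using ha : a = -1 ∨ a = 1) with rfl | rfl
    · exact hq ▸ fun _ => le_add_self
    · exact hq ▸ fun _ => le_self_add
  have hM : ∀ a ∈ pm, ∀ b ∈ pm, ∀ c ∈ pm,
      triangleMass (fun x => (μX x : ℝ≥0∞)) (fun y => (μY y : ℝ≥0∞)) (fun z => (μZ z : ℝ≥0∞))
        (A a) (B b) (C c) = ENNReal.ofReal (P a b c) := by
    intro a ha b hb c hc
    have hfin := triangleMass_ne_top hX hY hZ (le_one hA a ha) (le_one hB b hb) (le_one hC c hc)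
    rw [hP, ENNReal.ofReal_coe_nnreal, ← toNNReal_triangleMass hfin]
    exact (ENNReal.coe_toNNReal hfin).symm
  have key := triangleMass_disagreement_le hX hY hZ hA hB hC
  have hn : (-1 : ℝ) ∈ pm := by simp [pm]
  have hp : (1 : ℝ) ∈ pm := by simp [pm]
  have p1 := hP0 _ hp _ hp _ hp
  have p2 := hP0 _ hp _ hp _ hn
  have p3 := hP0 _ hp _ hn _ hp
  have p4 := hP0 _ hp _ hn _ hn
  have p5 := hP0 _ hn _ hp _ hp
  have p6 := hP0 _ hn _ hp _ hn
  have p7 := hP0 _ hn _ hn _ hp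
  have p8 := hP0 _ hn _ hn _ hn
  have hM' := fun {a} ha {b} hb {c} hc => hM a ha b hb c hc
  simp (discharger := assumption) only [← hA, ← hB, ← hC, ← triangleMass_add_left,
    ← triangleMass_add_middle, ← triangleMass_add_right, hM'] at key
  simp (discharger := positivity) only [← ENNReal.ofReal_add, ← ENNReal.ofReal_mul] at key
  rw [ENNReal.ofReal_le_ofReal_iff (by positivity)] at key
  have hne : (-1 : ℝ) ≠ 1 := by norm_num
  have hsq := sq_nonneg (∑ a ∈ pm, ∑ b ∈ pm, ∑ c ∈ pm, P a b c - 1)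
  simp only [corr, pm, Finset.sum_pair hne] at hsq ⊢
  linear_combination 2 * key + hsq
end

section
/- If a probability distribution P on ({-1,1})^3 is compatible with the Triangle scenario and satisfies ⟨A⟩ = 0, ⟨C⟩ = 0 and ⟨AC⟩ = 1 (A and C are unbiased and perfectly correlated), then ⟨AB⟩ = 0 and ⟨CB⟩ = 0; that is, both A and C are uncorrelated with (and hence, being unbiased binary variables, independent of) the third variable B. -/
open scoped BigOperators NNReal

theorem summable_of_tsum_eq_one {ι : Type*} {μ : ι → ℝ≥0} (hμ : ∑' i, μ i = 1) :
    Summable μ := by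
  by_contra h
  simp [tsum_eq_zero_of_not_summable h] at hμ

/-- A family dominated by a product probability mass function whose iterated sum vanishes is
identically zero. -/
theorem eq_zero_of_iterated_tsum_eq_zero {X Y Z : Type*} {μX : X → ℝ≥0} {μY : Y → ℝ≥0}
    {μZ : Z → ℝ≥0} (hX : ∑' x, μX x = 1) (hY : ∑' y, μY y = 1) (hZ : ∑' z, μZ z = 1)
    {t : X → Y → Z → ℝ≥0} (ht : ∀ x y z, t x y z ≤ μX x * μY y * μZ z)
    (h : ∑' (x : X) (y : Y) (z : Z), t x y z = 0) (x : X) (y : Y) (z : Z) : t x y z = 0 := by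
  have sX := summable_of_tsum_eq_one hX
  have sY := summable_of_tsum_eq_one hY
  have sZ := summable_of_tsum_eq_one hZ
  have s₃ : ∀ x y, Summable fun z => t x y z := fun x y =>
    NNReal.summable_of_le (ht x y) (sZ.mul_left _)
  have b₂ : ∀ x y, ∑' z, t x y z ≤ μX x * μY y := fun x y =>
    ((s₃ x y).tsum_le_tsum (ht x y) (sZ.mul_left _)).trans_eq (by
      rw [NNReal.tsum_mul_left, hZ, mul_one])
  have s₂ : ∀ x, Summable fun y => ∑' z, t x y z := fun x =>
    NNReal.summable_of_le (b₂ x) (sY.mul_left _)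
  have b₁ : ∀ x, ∑' (y) (z), t x y z ≤ μX x := fun x =>
    ((s₂ x).tsum_le_tsum (b₂ x) (sY.mul_left _)).trans_eq (by
      rw [NNReal.tsum_mul_left, hY, mul_one])
  have s₁ : Summable fun x => ∑' (y) (z), t x y z := NNReal.summable_of_le b₁ sX
  exact (s₃ x y).tsum_eq_zero_iff.1 ((s₂ x).tsum_eq_zero_iff.1 (s₁.tsum_eq_zero_iff.1 h x) y) z

theorem mul_eq_of_disjoint_supports {p p' r r' c c' : ℝ≥0} (hp : p' + p = 1) (hr : r' + r = 1)
    (hc : c' + c = 1) (h₁ : p = 0 ∨ c' = 0) (h₂ : p' = 0 ∨ c = 0) (h₃ : r = 0 ∨ c' = 0)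
    (h₄ : r' = 0 ∨ c = 0) : p * c = r := by
  by_cases h : c' = 0
  · obtain rfl : c = 1 := by rwa [h, zero_add] at hc
    rw [h₂.resolve_right one_ne_zero, zero_add] at hp
    rw [h₄.resolve_right one_ne_zero, zero_add] at hr
    rw [hp, hr, mul_one]
  · rw [h₁.resolve_right h, h₃.resolve_right h, zero_mul]

/-- If two outcomes of a triangle model almost surely agree, then the model distribution of the
agreeing outcomes factorizes. -/
theorem TriangleCompatible.exists_factorization {P : ℝ → ℝ → ℝ → ℝ} (hcomp : TriangleCompatible P)
    (h₁ : ∀ b ∈ pm, P 1 b (-1) = 0) (h₂ : ∀ b ∈ pm, P (-1) b 1 = 0) :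
    ∃ F G : ℝ → ℝ, ∀ a ∈ pm, ∀ b, P a b a = F a * G b := by
  obtain ⟨X, Y, Z, μX, μY, μZ, qA, qB, qC, hX, hY, hZ, hqA, hqB, hqC, hP⟩ := hcomp
  have le_one : ∀ {q : ℝ → ℝ≥0}, q (-1) + q 1 = 1 → ∀ a ∈ pm, q a ≤ 1 := by
    intro q hq a ha
    simp only [pm, Finset.mem_insert, Finset.mem_singleton] at ha
    rcases ha with rfl | rfl
    · exact le_self_add.trans_eq hq
    · exact le_add_self.trans_eq hq
  have vanish : ∀ a ∈ pm, ∀ c ∈ pm, (∀ b ∈ pm, P a b c = 0) → ∀ x y z,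
      μX x ≠ 0 → μY y ≠ 0 → μZ z ≠ 0 → qA (y, z) a = 0 ∨ qC (x, y) c = 0 := by
    intro a ha c hc h x y z hx hy hz
    have key : ∀ b ∈ pm,
        μX x * μY y * μZ z * qA (y, z) a * qB (x, z) b * qC (x, y) c = 0 := by
      intro b hb
      refine eq_zero_of_iterated_tsum_eq_zero hX hY hZ
        (t := fun x y z => μX x * μY y * μZ z * qA (y, z) a * qB (x, z) b * qC (x, y) c)
        (fun x y z => ?_) ?_ x y z
      · exact mul_le_of_le_of_le_one
          (mul_le_of_le_of_le_one (mul_le_of_le_of_le_one le_rfl (le_one (hqA _) a ha))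
            (le_one (hqB _) b hb)) (le_one (hqC _) c hc)
      · have := h b hb
        rw [hP] at this
        exact_mod_cast this
    have k₁ := key (-1) (by simp [pm])
    have k₂ := key 1 (by simp [pm])
    have : μX x * μY y * μZ z * qA (y, z) a * qC (x, y) c = 0 := by
      calc _ = μX x * μY y * μZ z * qA (y, z) a * (qB (x, z) (-1) + qB (x, z) 1)
            * qC (x, y) c := by rw [hqB, mul_one]
        _ = 0 := by rw [mul_add, add_mul, k₁, k₂, add_zero]
    simpa [hx, hy, hz] using this
  have v₁ := vanish 1 (by simp [pm]) (-1) (by simp [pm]) h₁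
  have v₂ := vanish (-1) (by simp [pm]) 1 (by simp [pm]) h₂
  obtain ⟨z₀, hz₀⟩ : ∃ z, μZ z ≠ 0 := by
    by_contra! h
    simp [h] at hZ
  have agree : ∀ a ∈ pm, ∀ x y z, μX x ≠ 0 → μY y ≠ 0 → μZ z ≠ 0 →
      qA (y, z) a * qC (x, y) a = qA (y, z₀) a := by
    intro a ha x y z hx hy hz
    simp only [pm, Finset.mem_insert, Finset.mem_singleton] at ha
    rcases ha with rfl | rfl
    · exact mul_eq_of_disjoint_supports ((add_comm _ _).trans (hqA (y, z)))
        ((add_comm _ _).trans (hqA (y, z₀))) ((add_comm _ _).trans (hqC (x, y)))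
        (v₂ x y z hx hy hz) (v₁ x y z hx hy hz) (v₂ x y z₀ hx hy hz₀) (v₁ x y z₀ hx hy hz₀)
    · exact mul_eq_of_disjoint_supports (hqA (y, z)) (hqA (y, z₀)) (hqC (x, y))
        (v₁ x y z hx hy hz) (v₂ x y z hx hy hz) (v₁ x y z₀ hx hy hz₀) (v₂ x y z₀ hx hy hz₀)
  refine ⟨fun a => ((∑' y, μY y * qA (y, z₀) a : ℝ≥0) : ℝ),
    fun b => ((∑' x, μX x * ∑' z, μZ z * qB (x, z) b : ℝ≥0) : ℝ), fun a ha b => ?_⟩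
  have term : ∀ x y z, μX x * μY y * μZ z * qA (y, z) a * qB (x, z) b * qC (x, y) a =
      μY y * qA (y, z₀) a * μX x * (μZ z * qB (x, z) b) := by
    intro x y z
    by_cases hx : μX x = 0
    · simp [hx]
    by_cases hy : μY y = 0
    · simp [hy]
    by_cases hz : μZ z = 0
    · simp [hz]
    rw [← agree a ha x y z hx hy hz]
    ring
  rw [hP, ← NNReal.coe_mul]
  congr 1
  simp only [term, NNReal.tsum_mul_left, NNReal.tsum_mul_right]
  simp only [mul_assoc, NNReal.tsum_mul_left]

/-- If a distribution on `{-1,1}³` compatible with the Triangle scenario has `A` and `C`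
unbiased and perfectly correlated (`⟨A⟩ = 0`, `⟨C⟩ = 0`, `⟨AC⟩ = 1`), then both `A` and `C`
are uncorrelated with the third variable `B`: `⟨AB⟩ = 0` and `⟨CB⟩ = 0`. -/
theorem triangle_perfect_correlation_monogamy (P : ℝ → ℝ → ℝ → ℝ)
    (hP0 : ∀ a ∈ pm, ∀ b ∈ pm, ∀ c ∈ pm, 0 ≤ P a b c)
    (hP1 : ∑ a ∈ pm, ∑ b ∈ pm, ∑ c ∈ pm, P a b c = 1)
    (hcomp : TriangleCompatible P)
    (hA : corr (fun a _ _ => a) P = 0)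
    (hC : corr (fun _ _ c => c) P = 0)
    (hAC : corr (fun a _ c => a * c) P = 1) :
    corr (fun a b _ => a * b) P = 0 ∧ corr (fun _ b c => c * b) P = 0 := by
  have hne : (-1 : ℝ) ≠ 1 := by norm_num
  have sum_pm : ∀ f : ℝ → ℝ, ∑ a ∈ pm, f a = f (-1) + f 1 := fun f => Finset.sum_pair hne
  have m₁ : (1 : ℝ) ∈ pm := by simp [pm]
  have m₂ : (-1 : ℝ) ∈ pm := by simp [pm]
  simp only [corr, sum_pm] at *
  have p₁ := hP0 1 m₁ 1 m₁ (-1) m₂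
  have p₂ := hP0 1 m₁ (-1) m₂ (-1) m₂
  have p₃ := hP0 (-1) m₂ 1 m₁ 1 m₁
  have p₄ := hP0 (-1) m₂ (-1) m₂ 1 m₁
  have e₁ : P 1 1 (-1) = 0 := by linarith
  have e₂ : P 1 (-1) (-1) = 0 := by linarith
  have e₃ : P (-1) 1 1 = 0 := by linarith
  have e₄ : P (-1) (-1) 1 = 0 := by linarith
  obtain ⟨F, G, h⟩ := hcomp.exists_factorization
    (by simp [pm, e₁, e₂]) (by simp [pm, e₃, e₄])
  simp only [e₁, e₂, e₃, e₄, h 1 m₁, h (-1) m₂] at hP1 hA ⊢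
  have hF : F 1 = F (-1) := by
    linear_combination (F (-1) - F 1) * hP1 + (F 1 + F (-1)) * hA
  rw [hF]
  constructor <;> ring
end

section
/- If a probability distribution P on ({-1,1})^3 is compatible with the Triangle scenario, then 0 ≤ 3 − ⟨A⟩ − ⟨B⟩ − ⟨C⟩ + 2⟨AB⟩ + 2⟨AC⟩ + 2⟨BC⟩ + ⟨ABC⟩ + ⟨A⟩⟨B⟩ + ⟨A⟩⟨C⟩ + ⟨B⟩⟨C⟩ − ⟨A⟩⟨BC⟩ − ⟨B⟩⟨AC⟩ − ⟨C⟩⟨AB⟩ + ⟨A⟩⟨B⟩⟨C⟩, where ⟨·⟩ denotes the expectation under P of the indicated product of coordinates (e.g. ⟨ABC⟩ := Σ_{a,b,c} a·b·c·P(a,b,c)). -/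
open scoped BigOperators NNReal

/-- The expectation `∑ i, μ i * f i` of `f` under the weights `μ`. -/
noncomputable def expect {ι : Type} (μ f : ι → ℝ) : ℝ := ∑' i, μ i * f i

/-- Nonnegative real weights of total mass one. -/
structure IsWeight {ι : Type} (μ : ι → ℝ) : Prop where
  nonneg : ∀ i, 0 ≤ μ i
  hasSum : HasSum μ 1

section Expect

variable {ι κ τ : Type} {μ : ι → ℝ} {ν : κ → ℝ} {ρ : τ → ℝ}

lemma expect_mul_left (μ : ι → ℝ) (c : ℝ) (f : ι → ℝ) :
    expect μ (fun i => c * f i) = c * expect μ f := by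
  simp only [expect, ← tsum_mul_left, mul_left_comm]

lemma expect_mul_right (μ : ι → ℝ) (f : ι → ℝ) (c : ℝ) :
    expect μ (fun i => f i * c) = expect μ f * c := by
  simp only [expect, ← tsum_mul_right, mul_assoc]

lemma IsWeight.expect_const (h : IsWeight μ) (c : ℝ) : expect μ (fun _ => c) = c := by
  simp [expect, tsum_mul_right, h.hasSum.tsum_eq]

lemma IsWeight.summable_mul (h : IsWeight μ) {f : ι → ℝ} (hf : ∀ i, |f i| ≤ 1) :
    Summable fun i => μ i * f i := by
  refine Summable.of_norm_bounded h.hasSum.summable fun i => ?_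
  rw [Real.norm_eq_abs, abs_mul, abs_of_nonneg (h.nonneg i)]
  exact mul_le_of_le_one_right (h.nonneg i) (hf i)

lemma IsWeight.abs_expect_le_one (h : IsWeight μ) {f : ι → ℝ} (hf : ∀ i, |f i| ≤ 1) :
    |expect μ f| ≤ 1 := by
  rw [← Real.norm_eq_abs]
  refine tsum_of_norm_bounded h.hasSum fun i => ?_
  rw [Real.norm_eq_abs, abs_mul, abs_of_nonneg (h.nonneg i)]
  exact mul_le_of_le_one_right (h.nonneg i) (hf i)

lemma IsWeight.prod (h : IsWeight μ) (k : IsWeight ν) :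
    IsWeight fun p : ι × κ => μ p.1 * ν p.2 where
  nonneg p := mul_nonneg (h.nonneg _) (k.nonneg _)
  hasSum := by
    have hs := h.hasSum.summable.mul_of_nonneg k.hasSum.summable h.nonneg k.nonneg
    simpa using h.hasSum.mul k.hasSum hs

lemma IsWeight.expect_prod (h : IsWeight μ) (k : IsWeight ν) {f : ι × κ → ℝ}
    (hf : ∀ p, |f p| ≤ 1) :
    expect (fun p : ι × κ => μ p.1 * ν p.2) f =
      expect μ fun i => expect ν fun j => f (i, j) := by
  simp only [expect]
  rw [((h.prod k).summable_mul hf).tsum_prod]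
  simp only [mul_assoc, tsum_mul_left]

lemma IsWeight.expect_comm (h : IsWeight μ) (k : IsWeight ν) {f : ι → κ → ℝ}
    (hf : ∀ i j, |f i j| ≤ 1) :
    (expect μ fun i => expect ν fun j => f i j) =
      expect ν fun j => expect μ fun i => f i j := by
  rw [← h.expect_prod k (f := fun p => f p.1 p.2) fun p => hf _ _,
    ← k.expect_prod h (f := fun p => f p.2 p.1) fun p => hf _ _]
  simp only [expect]
  rw [← (Equiv.prodComm ι κ).tsum_eq]
  simp [mul_comm]

lemma IsWeight.expect_rotate (h : IsWeight μ) (k : IsWeight ν) (l : IsWeight ρ)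
    {f : ι → κ → τ → ℝ} (hf : ∀ i j m, |f i j m| ≤ 1) :
    (expect μ fun i => expect ν fun j => expect ρ fun m => f i j m) =
      expect ν fun j => expect ρ fun m => expect μ fun i => f i j m := by
  rw [h.expect_comm k fun i j => l.abs_expect_le_one (hf i j)]
  congr 1
  ext j
  exact h.expect_comm l fun i m => hf i j m

lemma IsWeight.hasSum_triple (h : IsWeight μ) (k : IsWeight ν) (l : IsWeight ρ)
    {f : ι → κ → τ → ℝ} (hf : ∀ i j m, |f i j m| ≤ 1) :
    HasSum (fun p : ι × κ × τ => μ p.1 * (ν p.2.1 * ρ p.2.2) * f p.1 p.2.1 p.2.2)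
      (expect μ fun i => expect ν fun j => expect ρ fun m => f i j m) := by
  have hs := (h.prod (k.prod l)).summable_mul (f := fun p => f p.1 p.2.1 p.2.2)
    fun p => hf _ _ _
  convert hs.hasSum using 1
  have e := h.expect_prod (k.prod l) (f := fun p => f p.1 p.2.1 p.2.2) fun p => hf _ _ _
  refine Eq.trans ?_ e.symm
  congr 1
  ext i
  exact (k.expect_prod l (f := fun p => f i p.1 p.2) fun p => hf _ _ _).symm

end Expect

lemma abs_mul_le_one {s t : ℝ} (hs : |s| ≤ 1) (ht : |t| ≤ 1) : |s * t| ≤ 1 := by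
  rw [abs_mul]
  exact mul_le_one₀ hs (abs_nonneg t) ht

/-- The multilinear polynomial on the spiral inflation of the Triangle scenario whose
expectation is the right-hand side of the inequality. -/
def spiralPoly (a b c a' b' c' : ℝ) : ℝ :=
  3 - a' - b' - c' + a * b + b * c + c * a + a' * b + b' * c + c' * a + a * b * c
    + a * b' + b * c' + c * a' - a' * b' * c - b' * c' * a - c' * a' * b + a' * b' * c'

/-- A function affine on the line that is nonnegative at `±1` is nonnegative on `[-1, 1]`. -/
lemma nonneg_of_affine {f : ℝ → ℝ} {t : ℝ} (ht : |t| ≤ 1)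
    (h : f t = (1 + t) / 2 * f 1 + (1 - t) / 2 * f (-1))
    (hf : ∀ s, s = 1 ∨ s = -1 → 0 ≤ f s) : 0 ≤ f t := by
  obtain ⟨l, u⟩ := abs_le.1 ht
  rw [h]
  exact add_nonneg (mul_nonneg (by linarith) (hf _ (.inl rfl)))
    (mul_nonneg (by linarith) (hf _ (.inr rfl)))

lemma spiralPoly_nonneg {a b c a' b' c' : ℝ} (ha : |a| ≤ 1) (hb : |b| ≤ 1) (hc : |c| ≤ 1)
    (ha' : |a'| ≤ 1) (hb' : |b'| ≤ 1) (hc' : |c'| ≤ 1) : 0 ≤ spiralPoly a b c a' b' c' := by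
  refine nonneg_of_affine (f := fun a => spiralPoly a b c a' b' c') ha
    (by simp only [spiralPoly]; ring) fun a va => ?_
  refine nonneg_of_affine (f := fun b => spiralPoly a b c a' b' c') hb
    (by simp only [spiralPoly]; ring) fun b vb => ?_
  refine nonneg_of_affine (f := fun c => spiralPoly a b c a' b' c') hc
    (by simp only [spiralPoly]; ring) fun c vc => ?_
  refine nonneg_of_affine (f := fun a' => spiralPoly a b c a' b' c') ha'
    (by simp only [spiralPoly]; ring) fun a' va' => ?_
  refine nonneg_of_affine (f := fun b' => spiralPoly a b c a' b' c') hb'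
    (by simp only [spiralPoly]; ring) fun b' vb' => ?_
  refine nonneg_of_affine (f := fun c' => spiralPoly a b c a' b' c') hc'
    (by simp only [spiralPoly]; ring) fun c' vc' => ?_
  simp only [spiralPoly]
  rcases va with rfl | rfl <;> rcases vb with rfl | rfl <;> rcases vc with rfl | rfl <;>
  rcases va' with rfl | rfl <;> rcases vb' with rfl | rfl <;> rcases vc' with rfl | rfl <;>
  norm_num

section Triangle

variable {X Y Z : Type} {μ : X → ℝ} {ν : Y → ℝ} {ρ : Z → ℝ}

/-- The inequality for response functions `α`, `β`, `γ`, given the correlators as sums over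
all values of the latent variables. -/
lemma triangle_expect_nonneg (h : IsWeight μ) (k : IsWeight ν) (l : IsWeight ρ)
    {α : Y → Z → ℝ} {β : X → Z → ℝ} {γ : X → Y → ℝ}
    (hα : ∀ y z, |α y z| ≤ 1) (hβ : ∀ x z, |β x z| ≤ 1) (hγ : ∀ x y, |γ x y| ≤ 1)
    {A B C AB AC BC ABC : ℝ}
    (hA : HasSum (fun p : X × Y × Z => μ p.1 * (ν p.2.1 * ρ p.2.2) * α p.2.1 p.2.2) A)
    (hB : HasSum (fun p : X × Y × Z => μ p.1 * (ν p.2.1 * ρ p.2.2) * β p.1 p.2.2) B)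
    (hC : HasSum (fun p : X × Y × Z => μ p.1 * (ν p.2.1 * ρ p.2.2) * γ p.1 p.2.1) C)
    (hAB : HasSum (fun p : X × Y × Z =>
      μ p.1 * (ν p.2.1 * ρ p.2.2) * (α p.2.1 p.2.2 * β p.1 p.2.2)) AB)
    (hAC : HasSum (fun p : X × Y × Z =>
      μ p.1 * (ν p.2.1 * ρ p.2.2) * (α p.2.1 p.2.2 * γ p.1 p.2.1)) AC)
    (hBC : HasSum (fun p : X × Y × Z =>
      μ p.1 * (ν p.2.1 * ρ p.2.2) * (β p.1 p.2.2 * γ p.1 p.2.1)) BC)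
    (hABC : HasSum (fun p : X × Y × Z =>
      μ p.1 * (ν p.2.1 * ρ p.2.2) * (α p.2.1 p.2.2 * β p.1 p.2.2 * γ p.1 p.2.1)) ABC) :
    0 ≤ 3 - A - B - C + 2 * AB + 2 * AC + 2 * BC + ABC + A * B + A * C + B * C
      - A * BC - B * AC - C * AB + A * B * C := by
  set A' : Z → ℝ := fun z => expect ν fun y => α y z with hA'
  set B' : X → ℝ := fun x => expect ρ fun z => β x z with hB'
  set C' : Y → ℝ := fun y => expect μ fun x => γ x y with hC'
  have bA : ∀ z, |A' z| ≤ 1 := fun z => k.abs_expect_le_one fun y => hα y z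
  have bB : ∀ x, |B' x| ≤ 1 := fun x => l.abs_expect_le_one fun z => hβ x z
  have bC : ∀ y, |C' y| ≤ 1 := fun y => h.abs_expect_le_one fun x => hγ x y
  -- sums over the latent variables, iterated in the three cyclic orders
  have H {f : X → Y → Z → ℝ} (hf : ∀ x y z, |f x y z| ≤ 1) {v : ℝ}
      (hv : (expect μ fun x => expect ν fun y => expect ρ fun z => f x y z) = v) :
      HasSum (fun p : X × Y × Z => μ p.1 * (ν p.2.1 * ρ p.2.2) * f p.1 p.2.1 p.2.2) v :=
    hv ▸ h.hasSum_triple k l hf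
  have rot {f : X → Y → Z → ℝ} (hf : ∀ x y z, |f x y z| ≤ 1) := h.expect_rotate k l hf
  have rot' {f : X → Y → Z → ℝ} (hf : ∀ x y z, |f x y z| ≤ 1) :=
    (l.expect_rotate h k (f := fun z x y => f x y z) fun z x y => hf x y z).symm
  have eA : A = expect ρ A' := by
    rw [hA.unique (H (f := fun _ y z => α y z) (fun _ => hα) rfl), h.expect_const,
      k.expect_comm l hα]
  have eB : B = expect μ B' := by
    rw [hB.unique (H (f := fun x _ z => β x z) (fun x _ => hβ x) rfl)]
    simp only [k.expect_const, hB']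
  have eC : C = expect ν C' := by
    rw [hC.unique (H (f := fun x y _ => γ x y) (fun x y _ => hγ x y) rfl)]
    simp only [l.expect_const, hC']
    exact h.expect_comm k hγ
  have eA₂ : A = expect ν fun y => expect ρ fun z => α y z := by
    rw [eA, k.expect_comm l hα]
  have eB₂ : B = expect ρ fun z => expect μ fun x => β x z := by
    rw [eB, h.expect_comm l hβ]
  have eC₂ : C = expect μ fun x => expect ν fun y => γ x y := by
    rw [eC, h.expect_comm k hγ]
  have eAB : AB = expect ρ fun z => A' z * expect μ fun x => β x z := by
    have b x y z := abs_mul_le_one (hα y z) (hβ x z)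
    rw [hAB.unique (H b rfl), rot' b]
    simp only [expect_mul_left, expect_mul_right, hA']
  have eBC : BC = expect μ fun x => B' x * expect ν fun y => γ x y := by
    have b x y z := abs_mul_le_one (hβ x z) (hγ x y)
    rw [hBC.unique (H b rfl)]
    simp only [expect_mul_left, expect_mul_right, hB']
  have eAC : AC = expect ν fun y => (expect ρ fun z => α y z) * C' y := by
    have b x y z := abs_mul_le_one (hα y z) (hγ x y)
    rw [hAC.unique (H b rfl), rot b]
    simp only [expect_mul_left, expect_mul_right, hC']
  have s1 := (h.prod (k.prod l)).hasSum.mul_right 3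
  have sA := H (f := fun _ _ z => A' z) (v := A) (fun _ _ => bA) (by
    simp only [h.expect_const, k.expect_const, eA])
  have sB := H (f := fun x _ _ => B' x) (v := B) (fun x _ _ => bB x) (by
    simp only [k.expect_const, l.expect_const, eB])
  have sC := H (f := fun _ y _ => C' y) (v := C) (fun _ y _ => bC y) (by
    simp only [h.expect_const, l.expect_const, eC])
  have sAb := by
    have b (x : X) (_ : Y) z := abs_mul_le_one (bA z) (hβ x z)
    refine H (v := AB) b ?_
    rw [rot' b, eAB]
    simp only [k.expect_const, expect_mul_left]
  have sBc := by
    have b x y (_ : Z) := abs_mul_le_one (bB x) (hγ x y)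
    refine H (v := BC) b ?_
    rw [eBC]
    simp only [l.expect_const, expect_mul_left]
  have sCa := by
    have b (_ : X) y z := abs_mul_le_one (hα y z) (bC y)
    refine H (v := AC) b ?_
    rw [rot b, eAC]
    simp only [h.expect_const, expect_mul_right]
  have saB := by
    have b x y z := abs_mul_le_one (hα y z) (bB x)
    refine H (v := A * B) b ?_
    rw [eA₂, eB]
    simp only [expect_mul_left, expect_mul_right]
  have sbC := by
    have b x y z := abs_mul_le_one (hβ x z) (bC y)
    refine H (v := B * C) b ?_
    rw [rot' b, eB₂, eC]
    simp only [expect_mul_left, expect_mul_right]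
  have scA := by
    have b x y z := abs_mul_le_one (bA z) (hγ x y)
    refine H (v := A * C) b ?_
    rw [eA, eC₂]
    simp only [expect_mul_left, expect_mul_right]
  have sABc := by
    have b x y z := abs_mul_le_one (bA z) (abs_mul_le_one (bB x) (hγ x y))
    refine H (v := A * BC) b ?_
    rw [eA, eBC]
    simp only [expect_mul_left, expect_mul_right]
  have sBCa := by
    have b x y z := abs_mul_le_one (bB x) (abs_mul_le_one (hα y z) (bC y))
    refine H (v := B * AC) b ?_
    rw [eB, eAC]
    simp only [expect_mul_left, expect_mul_right]
  have sCAb := by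
    have b x y z := abs_mul_le_one (bC y) (abs_mul_le_one (bA z) (hβ x z))
    refine H (v := C * AB) b ?_
    rw [rot' b, eC, eAB]
    simp only [expect_mul_left, expect_mul_right]
  have sABC := by
    have b x y z := abs_mul_le_one (abs_mul_le_one (bA z) (bB x)) (bC y)
    refine H (v := A * B * C) b ?_
    rw [eA, eB, eC]
    simp only [expect_mul_left, expect_mul_right]
  have total := (((((((((((((((((s1.sub sA).sub sB).sub sC).add hAB).add hBC).add hAC).add
    sAb).add sBc).add sCa).add hABC).add saB).add sbC).add scA).sub sABc).sub sBCa).sub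
    sCAb).add sABC)
  have pos := total.nonneg fun p => by
    have hp := mul_nonneg ((h.prod (k.prod l)).nonneg p)
      (spiralPoly_nonneg (hα p.2.1 p.2.2) (hβ p.1 p.2.2) (hγ p.1 p.2.1)
        (bA p.2.2) (bB p.1) (bC p.2.1))
    refine hp.trans_eq ?_
    simp only [spiralPoly]
    ring
  linarith

end Triangle

lemma sum_pm (f : ℝ → ℝ) : ∑ a ∈ pm, f a = f (-1) + f 1 :=
  Finset.sum_pair (by norm_num)

lemma isWeight_coe {ι : Type} {μ : ι → ℝ≥0} (h : ∑' i, μ i = 1) :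
    IsWeight fun i => (μ i : ℝ) where
  nonneg i := (μ i).2
  hasSum := by
    have hs : Summable μ := by
      by_contra hs
      simp [tsum_eq_zero_of_not_summable hs] at h
    have := NNReal.hasSum_coe.2 hs.hasSum
    simpa [h] using this

/-- Causal compatibility inequality (class of Eq. (25) of the paper) for the Triangle
scenario with binary `±1`-valued observed variables. -/
theorem triangle_inequality_class_two (P : ℝ → ℝ → ℝ → ℝ)
    (hP0 : ∀ a ∈ pm, ∀ b ∈ pm, ∀ c ∈ pm, 0 ≤ P a b c)
    (hP1 : ∑ a ∈ pm, ∑ b ∈ pm, ∑ c ∈ pm, P a b c = 1)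
    (hcomp : TriangleCompatible P) :
    0 ≤ 3 - corr (fun a _ _ => a) P - corr (fun _ b _ => b) P - corr (fun _ _ c => c) P
      + 2 * corr (fun a b _ => a * b) P + 2 * corr (fun a _ c => a * c) P
      + 2 * corr (fun _ b c => b * c) P
      + corr (fun a b c => a * b * c) P
      + corr (fun a _ _ => a) P * corr (fun _ b _ => b) P
      + corr (fun a _ _ => a) P * corr (fun _ _ c => c) P
      + corr (fun _ b _ => b) P * corr (fun _ _ c => c) P
      - corr (fun a _ _ => a) P * corr (fun _ b c => b * c) P
      - corr (fun _ b _ => b) P * corr (fun a _ c => a * c) P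
      - corr (fun _ _ c => c) P * corr (fun a b _ => a * b) P
      + corr (fun a _ _ => a) P * corr (fun _ b _ => b) P * corr (fun _ _ c => c) P := by
  obtain ⟨X, Y, Z, μX, μY, μZ, qA, qB, qC, hX, hY, hZ, hqA, hqB, hqC, hP⟩ := hcomp
  have h := isWeight_coe hX
  have k := isWeight_coe hY
  have l := isWeight_coe hZ
  have pA yz : (qA yz (-1) : ℝ) = 1 - qA yz 1 := by
    rw [eq_sub_iff_add_eq]; exact_mod_cast hqA yz
  have pB xz : (qB xz (-1) : ℝ) = 1 - qB xz 1 := by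
    rw [eq_sub_iff_add_eq]; exact_mod_cast hqB xz
  have pC xy : (qC xy (-1) : ℝ) = 1 - qC xy 1 := by
    rw [eq_sub_iff_add_eq]; exact_mod_cast hqC xy
  have le_one {u v : ℝ≥0} (huv : u + v = 1) : u ≤ 1 ∧ v ≤ 1 :=
    ⟨huv ▸ le_self_add, huv ▸ le_add_self⟩
  have hsum : ∀ a ∈ pm, ∀ b ∈ pm, ∀ c ∈ pm, HasSum (fun p : X × Y × Z =>
      (μX p.1 : ℝ) * (μY p.2.1 * μZ p.2.2) *
        (qA (p.2.1, p.2.2) a * qB (p.1, p.2.2) b * qC (p.1, p.2.1) c)) (P a b c) := by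
    intro a ha b hb c hc
    have mem {t : ℝ} (ht : t ∈ pm) {u : ℝ → ℝ≥0} (hu : u (-1) + u 1 = 1) :
        |(u t : ℝ)| ≤ 1 := by
      rw [NNReal.abs_eq]
      have ht' : t = -1 ∨ t = 1 := by simpa [pm] using ht
      rcases ht' with rfl | rfl
      · exact_mod_cast (le_one hu).1
      · exact_mod_cast (le_one hu).2
    have := h.hasSum_triple k l (f := fun x y z => qA (y, z) a * qB (x, z) b * qC (x, y) c)
      fun x y z => abs_mul_le_one (abs_mul_le_one (mem ha (hqA _)) (mem hb (hqB _)))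
        (mem hc (hqC _))
    convert this using 1
    rw [hP]
    push_cast [NNReal.coe_tsum]
    simp only [expect, ← tsum_mul_left, mul_assoc]
  have hcorr (f : ℝ → ℝ → ℝ → ℝ) : HasSum (fun p : X × Y × Z =>
      (μX p.1 : ℝ) * (μY p.2.1 * μZ p.2.2) * ∑ a ∈ pm, ∑ b ∈ pm, ∑ c ∈ pm, f a b c *
        (qA (p.2.1, p.2.2) a * qB (p.1, p.2.2) b * qC (p.1, p.2.1) c)) (corr f P) := by
    have := hasSum_sum fun a ha => hasSum_sum fun b hb => hasSum_sum fun c hc =>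
      (hsum a ha b hb c hc).mul_left (f a b c)
    simp only [Finset.mul_sum, mul_left_comm _ (f _ _ _)]
    exact this
  have bound {u v : ℝ≥0} (huv : u + v = 1) : |(2 * v - 1 : ℝ)| ≤ 1 := by
    have h1 : (v : ℝ) ≤ 1 := by exact_mod_cast (le_one huv).2
    rw [abs_le]
    constructor <;> linarith [v.2]
  refine triangle_expect_nonneg h k l
    (α := fun y z => 2 * qA (y, z) 1 - 1) (β := fun x z => 2 * qB (x, z) 1 - 1)
    (γ := fun x y => 2 * qC (x, y) 1 - 1) (fun _ _ => bound (hqA _)) (fun _ _ => bound (hqB _))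
    (fun _ _ => bound (hqC _)) ?_ ?_ ?_ ?_ ?_ ?_ ?_ <;>
  · convert hcorr _ using 3
    simp only [sum_pm, pA, pB, pC]
    ring
end

section
/- If a probability distribution P on ({-1,1})^3 is compatible with the Triangle scenario, then 0 ≤ 4 + 2⟨C⟩ − 2⟨AB⟩ − 3⟨AC⟩ − 2⟨BC⟩ − ⟨ABC⟩ + ⟨A⟩⟨B⟩⟨C⟩ + 2⟨A⟩⟨B⟩ + ⟨A⟩⟨C⟩ − ⟨A⟩⟨BC⟩ − ⟨C⟩⟨AB⟩, where ⟨·⟩ denotes the expectation under P of the indicated product of coordinates. -/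
open scoped BigOperators NNReal

/-- The mean of `f` with respect to the weights `p`. -/
noncomputable def wmean {X : Type*} (p : X → ℝ≥0) (f : X → ℝ) : ℝ := ∑' x, (p x : ℝ) * f x

section Mean

variable {X Y Z : Type*} {p : X → ℝ≥0} {q : Y → ℝ≥0} {r : Z → ℝ≥0}

lemma hasSum_coe_of_tsum_eq_one (hp : ∑' x, p x = 1) : HasSum (fun x => (p x : ℝ)) 1 := by
  have hs : Summable p := by
    by_contra h
    rw [tsum_eq_zero_of_not_summable h] at hp
    exact zero_ne_one hp
  have h := hs.hasSum
  rw [hp] at h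
  simpa using NNReal.hasSum_coe.2 h

lemma wmean_const (hp : ∑' x, p x = 1) (c : ℝ) : wmean p (fun _ => c) = c := by
  rw [wmean, tsum_mul_right, (hasSum_coe_of_tsum_eq_one hp).tsum_eq, one_mul]

lemma wmean_const_mul (c : ℝ) (f : X → ℝ) :
    wmean p (fun x => c * f x) = c * wmean p f := by
  simp only [wmean, mul_left_comm _ c, tsum_mul_left]

lemma wmean_mul_const (c : ℝ) (f : X → ℝ) :
    wmean p (fun x => f x * c) = wmean p f * c := by
  simp only [wmean, ← mul_assoc, tsum_mul_right]

lemma summable_mul_of_abs_le_one {w f : X → ℝ} (hw : Summable w) (hw0 : ∀ x, 0 ≤ w x)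
    (hf : ∀ x, |f x| ≤ 1) : Summable (fun x => w x * f x) := by
  refine Summable.of_norm_bounded hw fun x => ?_
  rw [Real.norm_eq_abs, abs_mul, abs_of_nonneg (hw0 x)]
  exact mul_le_of_le_one_right (hw0 x) (hf x)

lemma abs_wmean_le_one (hp : ∑' x, p x = 1) {f : X → ℝ} (hf : ∀ x, |f x| ≤ 1) :
    |wmean p f| ≤ 1 := by
  have hp' := hasSum_coe_of_tsum_eq_one hp
  rw [← Real.norm_eq_abs]
  refine tsum_of_norm_bounded hp' fun x => ?_
  rw [Real.norm_eq_abs, abs_mul, NNReal.abs_eq]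
  exact mul_le_of_le_one_right (p x).2 (hf x)

lemma summable_coe_mul_coe (hp : ∑' x, p x = 1) (hq : ∑' y, q y = 1) :
    Summable (fun w : X × Y => (p w.1 : ℝ) * q w.2) :=
  (hasSum_coe_of_tsum_eq_one hp).summable.mul_of_nonneg
    (hasSum_coe_of_tsum_eq_one hq).summable (fun x => (p x).2) (fun y => (q y).2)

lemma hasSum_wmean_wmean (hp : ∑' x, p x = 1) (hq : ∑' y, q y = 1) {f : X → Y → ℝ}
    (hf : ∀ x y, |f x y| ≤ 1) :
    HasSum (fun w : X × Y => (p w.1 : ℝ) * q w.2 * f w.1 w.2)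
      (wmean p fun x => wmean q fun y => f x y) := by
  have hs := summable_mul_of_abs_le_one (f := fun w : X × Y => f w.1 w.2)
    (summable_coe_mul_coe hp hq) (fun w => by positivity) (fun w => hf w.1 w.2)
  have h := hs.hasSum
  rw [hs.tsum_prod] at h
  simpa only [wmean, mul_assoc, tsum_mul_left] using h

lemma wmean_comm (hp : ∑' x, p x = 1) (hq : ∑' y, q y = 1) {f : X → Y → ℝ}
    (hf : ∀ x y, |f x y| ≤ 1) :
    (wmean p fun x => wmean q fun y => f x y) = wmean q fun y => wmean p fun x => f x y := by
  have h := (Equiv.prodComm Y X).hasSum_iff.2 (hasSum_wmean_wmean hp hq hf)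
  refine h.unique ?_
  convert hasSum_wmean_wmean hq hp (f := fun y x => f x y) (fun y x => hf x y) using 2 with w
  simp [mul_comm]

lemma hasSum_wmean_wmean_wmean (hp : ∑' x, p x = 1) (hq : ∑' y, q y = 1) (hr : ∑' z, r z = 1)
    {f : X → Y → Z → ℝ} (hf : ∀ x y z, |f x y z| ≤ 1) :
    HasSum (fun w : X × Y × Z => (p w.1 : ℝ) * (q w.2.1 * r w.2.2) * f w.1 w.2.1 w.2.2)
      (wmean p fun x => wmean q fun y => wmean r fun z => f x y z) := by
  have hs := summable_mul_of_abs_le_one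
    (w := fun w : X × Y × Z => (p w.1 : ℝ) * (q w.2.1 * r w.2.2))
    (f := fun w : X × Y × Z => f w.1 w.2.1 w.2.2)
    ((hasSum_coe_of_tsum_eq_one hp).summable.mul_of_nonneg (summable_coe_mul_coe hq hr)
      (fun x => (p x).2) (fun w => by positivity))
    (fun w => by positivity) (fun w => hf _ _ _)
  have h := hs.hasSum
  rw [hs.tsum_prod] at h
  convert h using 1
  refine tsum_congr fun x => ?_
  dsimp only
  rw [← (hasSum_wmean_wmean hq hr (hf x)).tsum_eq, ← tsum_mul_left]
  simp only [mul_assoc]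

end Mean

lemma nonneg_of_affine_s6 {t : ℝ → ℝ}
    (h : ∀ x, t x = (t 1 + t (-1)) / 2 + (t 1 - t (-1)) / 2 * x)
    {x : ℝ} (hx : |x| ≤ 1) (h₁ : 0 ≤ t 1) (h₂ : 0 ≤ t (-1)) : 0 ≤ t x := by
  obtain ⟨hl, hu⟩ := abs_le.1 hx
  rw [h]
  nlinarith

/-- The polynomial inequality on the cube `[-1, 1]⁶` whose average is the inequality for the
Triangle scenario. -/
lemma spiral_polynomial_nonneg {a b c α β γ : ℝ} (ha : |a| ≤ 1) (hb : |b| ≤ 1) (hc : |c| ≤ 1)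
    (hα : |α| ≤ 1) (hβ : |β| ≤ 1) (hγ : |γ| ≤ 1) :
    0 ≤ 4 + c + γ - a * b - a * c - a * β + a * γ - b * c + b * α - b * γ - 2 * (c * α)
      + α * β - a * b * c - a * β * γ - b * α * γ + α * β * γ := by
  obtain ⟨Q, hQ⟩ : ∃ Q : ℝ → ℝ → ℝ → ℝ → ℝ → ℝ → ℝ, ∀ a b c α β γ, Q a b c α β γ =
      4 + c + γ - a * b - a * c - a * β + a * γ - b * c + b * α - b * γ - 2 * (c * α)
        + α * β - a * b * c - a * β * γ - b * α * γ + α * β * γ :=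
    ⟨_, fun _ _ _ _ _ _ => rfl⟩
  rw [← hQ]
  refine nonneg_of_affine_s6 (t := fun a => Q a b c α β γ) (fun x => by simp only [hQ]; ring)
    ha ?_ ?_ <;>
  refine nonneg_of_affine_s6 (t := fun b => Q _ b c α β γ) (fun x => by simp only [hQ]; ring)
    hb ?_ ?_ <;>
  refine nonneg_of_affine_s6 (t := fun c => Q _ _ c α β γ) (fun x => by simp only [hQ]; ring)
    hc ?_ ?_ <;>
  refine nonneg_of_affine_s6 (t := fun α => Q _ _ _ α β γ) (fun x => by simp only [hQ]; ring)
    hα ?_ ?_ <;>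
  refine nonneg_of_affine_s6 (t := fun β => Q _ _ _ _ β γ) (fun x => by simp only [hQ]; ring)
    hβ ?_ ?_ <;>
  refine nonneg_of_affine_s6 (t := fun γ => Q _ _ _ _ _ γ) (fun x => by simp only [hQ]; ring)
    hγ ?_ ?_ <;>
  norm_num [hQ]

section Triangle

variable {X Y Z : Type*} {p : X → ℝ≥0} {q : Y → ℝ≥0} {r : Z → ℝ≥0}
  {A : Y → Z → ℝ} {B : X → Z → ℝ} {C : X → Y → ℝ}

/-- The inequality for the Triangle scenario, in terms of the conditional expectations `A`, `B`,
`C` of the observed variables given their latent parents. -/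
lemma wmean_triangle_inequality (hp : ∑' x, p x = 1) (hq : ∑' y, q y = 1) (hr : ∑' z, r z = 1)
    (hA : ∀ y z, |A y z| ≤ 1) (hB : ∀ x z, |B x z| ≤ 1) (hC : ∀ x y, |C x y| ≤ 1)
    {eA eB eC eAB eAC eBC eABC : ℝ}
    (hEA : eA = wmean p fun _ => wmean q fun y => wmean r fun z => A y z)
    (hEB : eB = wmean p fun x => wmean q fun _ => wmean r fun z => B x z)
    (hEC : eC = wmean p fun x => wmean q fun y => wmean r fun _ => C x y)
    (hEAB : eAB = wmean p fun x => wmean q fun y => wmean r fun z => A y z * B x z)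
    (hEAC : eAC = wmean p fun x => wmean q fun y => wmean r fun z => A y z * C x y)
    (hEBC : eBC = wmean p fun x => wmean q fun y => wmean r fun z => B x z * C x y)
    (hEABC : eABC = wmean p fun x => wmean q fun y => wmean r fun z => A y z * B x z * C x y) :
    0 ≤ 4 + 2 * eC - 2 * eAB - 3 * eAC - 2 * eBC - eABC + eA * eB * eC + 2 * eA * eB
      + eA * eC - eA * eBC - eC * eAB := by
  set α : Y → ℝ := fun y => wmean r fun z => A y z with hα
  set β : Z → ℝ := fun z => wmean p fun x => B x z with hβ
  set γ : X → ℝ := fun x => wmean q fun y => C x y with hγ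
  have bα (y) : |α y| ≤ 1 := abs_wmean_le_one hr (hA y)
  have bβ (z) : |β z| ≤ 1 := abs_wmean_le_one hp fun x => hB x z
  have bγ (x) : |γ x| ≤ 1 := abs_wmean_le_one hq (hC x)
  have eA' : eA = wmean q α := by rw [hEA, wmean_const hp]
  have eB' : eB = wmean p fun x => wmean r fun z => B x z := by
    simp only [hEB, wmean_const hq]
  have eB'' : eB = wmean r β := eB'.trans (wmean_comm hp hr hB)
  have eC' : eC = wmean p γ := by simp only [hEC, wmean_const hr, hγ]
  have eAB' : eAB = wmean q fun y => wmean r fun z => A y z * β z := by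
    have h (y) : (wmean r fun z => A y z * β z) =
        wmean p fun x => wmean r fun z => A y z * B x z := by
      rw [wmean_comm hp hr fun x z => abs_mul_le_one (hA y z) (hB x z)]
      simp only [wmean_const_mul, hβ]
    simp only [h]
    rw [hEAB]
    exact wmean_comm hp hq fun x y =>
      abs_wmean_le_one hr fun z => abs_mul_le_one (hA y z) (hB x z)
  have eAC' : eAC = wmean p fun x => wmean q fun y => α y * C x y := by
    simp only [hEAC, wmean_mul_const, hα]
  have eBC' : eBC = wmean p fun x => (wmean r fun z => B x z) * γ x := by
    simp only [hEBC, wmean_mul_const, wmean_const_mul, hγ]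
  have S {f : X → Y → Z → ℝ} {e : ℝ} (hf : ∀ x y z, |f x y z| ≤ 1)
      (h : (wmean p fun x => wmean q fun y => wmean r fun z => f x y z) = e) :
      HasSum (fun w : X × Y × Z => (p w.1 : ℝ) * (q w.2.1 * r w.2.2) * f w.1 w.2.1 w.2.2) e :=
    h ▸ hasSum_wmean_wmean_wmean hp hq hr hf
  have s1 := (S (f := fun _ _ _ => 1) (e := 1) (by simp)
    (by simp only [wmean_const hp, wmean_const hq, wmean_const hr])).mul_left 4
  have sC := S (fun x y _ => hC x y) hEC.symm
  have sγ := S (e := eC) (fun x _ _ => bγ x) (by simp only [wmean_const hq, wmean_const hr, eC'])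
  have sAB := S (fun x y z => abs_mul_le_one (hA y z) (hB x z)) hEAB.symm
  have sAC := S (fun x y z => abs_mul_le_one (hA y z) (hC x y)) hEAC.symm
  have sAβ := S (e := eAB) (fun _ y z => abs_mul_le_one (hA y z) (bβ z))
    (by simp only [wmean_const hp, eAB'])
  have sAγ := S (e := eA * eC) (fun x y z => abs_mul_le_one (hA y z) (bγ x))
    (by simp only [wmean_mul_const, wmean_const_mul, eA', eC', hα])
  have sBC := S (fun x y z => abs_mul_le_one (hB x z) (hC x y)) hEBC.symm
  have sBα := S (e := eA * eB) (fun x y z => abs_mul_le_one (hB x z) (bα y))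
    (by simp only [wmean_mul_const, wmean_const_mul, eA', eB', mul_comm (wmean q α)])
  have sBγ := S (e := eBC) (fun x _ z => abs_mul_le_one (hB x z) (bγ x))
    (by simp only [wmean_mul_const, wmean_const hq, eBC'])
  have sCα := (S (e := eAC) (fun x y _ => abs_mul_le_one (hC x y) (bα y))
    (by simp only [wmean_const hr, eAC', mul_comm])).mul_left 2
  have sαβ := S (e := eA * eB) (fun _ y z => abs_mul_le_one (bα y) (bβ z))
    (by simp only [wmean_const hp, wmean_mul_const, wmean_const_mul, eA', eB''])
  have sABC := S (fun x y z => abs_mul_le_one (abs_mul_le_one (hA y z) (hB x z)) (hC x y))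
    hEABC.symm
  have sAβγ := S (e := eAB * eC)
    (fun x y z => abs_mul_le_one (abs_mul_le_one (hA y z) (bβ z)) (bγ x))
    (by simp only [wmean_mul_const, wmean_const_mul, eAB', eC'])
  have sBαγ := S (e := eA * eBC)
    (fun x y z => abs_mul_le_one (abs_mul_le_one (hB x z) (bα y)) (bγ x))
    (by simp only [wmean_mul_const, wmean_const_mul, eA', eBC', mul_right_comm _ (wmean q α)]
        rw [mul_comm])
  have sαβγ := S (e := eA * eB * eC)
    (fun x y z => abs_mul_le_one (abs_mul_le_one (bα y) (bβ z)) (bγ x))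
    (by simp only [wmean_mul_const, wmean_const_mul, eA', eB'', eC'])
  have total := ((((((((((((((s1.add sC).add sγ).sub sAB).sub sAC).sub sAβ).add sAγ).sub
    sBC).add sBα).sub sBγ).sub sCα).add sαβ).sub sABC).sub sAβγ).sub sBαγ).add sαβγ
  have h := total.nonneg fun w => by
    have hw : (0 : ℝ) ≤ (p w.1 : ℝ) * (q w.2.1 * r w.2.2) := by positivity
    have := mul_nonneg hw (spiral_polynomial_nonneg (hA w.2.1 w.2.2) (hB w.1 w.2.2)
      (hC w.1 w.2.1) (bα w.2.1) (bβ w.2.2) (bγ w.1))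
    refine this.trans_eq ?_
    ring
  linarith

end Triangle

lemma corr_eq_wmean {P : ℝ → ℝ → ℝ → ℝ} {X Y Z : Type} {p : X → ℝ≥0} {q : Y → ℝ≥0}
    {r : Z → ℝ≥0} {qA : Y × Z → ℝ → ℝ≥0} {qB : X × Z → ℝ → ℝ≥0} {qC : X × Y → ℝ → ℝ≥0}
    (hp : ∑' x, p x = 1) (hq : ∑' y, q y = 1) (hr : ∑' z, r z = 1)
    (hA : ∀ w, ∀ a ∈ pm, qA w a ≤ 1) (hB : ∀ w, ∀ b ∈ pm, qB w b ≤ 1)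
    (hC : ∀ w, ∀ c ∈ pm, qC w c ≤ 1)
    (hP : ∀ a b c, P a b c = ((∑' (x : X) (y : Y) (z : Z),
        p x * q y * r z * qA (y, z) a * qB (x, z) b * qC (x, y) c : ℝ≥0) : ℝ))
    {f : ℝ → ℝ → ℝ → ℝ} {g : X → Y → Z → ℝ} (hg : ∀ x y z, |g x y z| ≤ 1)
    (hfg : ∀ x y z, ∑ a ∈ pm, ∑ b ∈ pm, ∑ c ∈ pm,
      f a b c * (qA (y, z) a * qB (x, z) b * qC (x, y) c) = g x y z) :
    corr f P = wmean p fun x => wmean q fun y => wmean r fun z => g x y z := by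
  have hS (a) (ha : a ∈ pm) (b) (hb : b ∈ pm) (c) (hc : c ∈ pm) :
      HasSum (fun w : X × Y × Z => (p w.1 : ℝ) * (q w.2.1 * r w.2.2) *
        (qA (w.2.1, w.2.2) a * qB (w.1, w.2.2) b * qC (w.1, w.2.1) c)) (P a b c) := by
    have habs {s : ℝ≥0} (hs : s ≤ 1) : |(s : ℝ)| ≤ 1 := by simpa using hs
    convert hasSum_wmean_wmean_wmean hp hq hr
      (f := fun x y z => (qA (y, z) a * qB (x, z) b * qC (x, y) c : ℝ))
      (fun x y z => abs_mul_le_one (abs_mul_le_one (habs (hA _ a ha)) (habs (hB _ b hb)))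
        (habs (hC _ c hc))) using 1
    rw [hP]
    simp only [wmean, NNReal.coe_tsum, NNReal.coe_mul, ← tsum_mul_left, mul_assoc]
  refine HasSum.unique ?_ (hasSum_wmean_wmean_wmean hp hq hr hg)
  have h := hasSum_sum fun a (ha : a ∈ pm) => hasSum_sum fun b (hb : b ∈ pm) =>
    hasSum_sum fun c (hc : c ∈ pm) => (hS a ha b hb c hc).mul_left (f a b c)
  simp only [← hfg, Finset.mul_sum, mul_left_comm _ (f _ _ _)]
  exact h

/-- Causal compatibility inequality (class of Eq. (26) of the paper) for the Triangle
scenario with binary `±1`-valued observed variables. -/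
theorem triangle_inequality_class_three (P : ℝ → ℝ → ℝ → ℝ)
    (hP0 : ∀ a ∈ pm, ∀ b ∈ pm, ∀ c ∈ pm, 0 ≤ P a b c)
    (hP1 : ∑ a ∈ pm, ∑ b ∈ pm, ∑ c ∈ pm, P a b c = 1)
    (hcomp : TriangleCompatible P) :
    0 ≤ 4 + 2 * corr (fun _ _ c => c) P
      - 2 * corr (fun a b _ => a * b) P - 3 * corr (fun a _ c => a * c) P
      - 2 * corr (fun _ b c => b * c) P
      - corr (fun a b c => a * b * c) P
      + corr (fun a _ _ => a) P * corr (fun _ b _ => b) P * corr (fun _ _ c => c) P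
      + 2 * corr (fun a _ _ => a) P * corr (fun _ b _ => b) P
      + corr (fun a _ _ => a) P * corr (fun _ _ c => c) P
      - corr (fun a _ _ => a) P * corr (fun _ b c => b * c) P
      - corr (fun _ _ c => c) P * corr (fun a b _ => a * b) P := by
  obtain ⟨X, Y, Z, p, q, r, qA, qB, qC, hp, hq, hr, hA, hB, hC, hP⟩ := hcomp
  have hle {W : Type} {k : W → ℝ → ℝ≥0} (hk : ∀ w, k w (-1) + k w 1 = 1) (w) (a) (ha : a ∈ pm) :
      k w a ≤ 1 := by
    rw [← hk w]
    obtain rfl | rfl : a = -1 ∨ a = 1 := by simpa [pm] using ha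
    · exact le_self_add
    · exact le_add_self
  have hneg {W : Type} {k : W → ℝ → ℝ≥0} (hk : ∀ w, k w (-1) + k w 1 = 1) (w) :
      (k w (-1) : ℝ) = 1 - k w 1 :=
    eq_sub_of_add_eq (by exact_mod_cast hk w)
  have habs {W : Type} {k : W → ℝ → ℝ≥0} (hk : ∀ w, k w (-1) + k w 1 = 1) (w) :
      |2 * (k w 1 : ℝ) - 1| ≤ 1 := by
    have h₁ : (k w 1 : ℝ) ≤ 1 := hle hk w 1 (by simp [pm])
    rw [abs_le]
    constructor <;> linarith [(k w 1).2]
  have bA (y z) := habs hA (y, z)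
  have bB (x z) := habs hB (x, z)
  have bC (x y) := habs hC (x, y)
  have hE {f : ℝ → ℝ → ℝ → ℝ} {g : X → Y → Z → ℝ} :=
    corr_eq_wmean hp hq hr (hle hA) (hle hB) (hle hC) hP (f := f) (g := g)
  refine wmean_triangle_inequality hp hq hr bA bB bC
    (hE (fun x y z => bA y z) ?_) (hE (fun x y z => bB x z) ?_) (hE (fun x y z => bC x y) ?_)
    (hE (fun x y z => abs_mul_le_one (bA y z) (bB x z)) ?_)
    (hE (fun x y z => abs_mul_le_one (bA y z) (bC x y)) ?_)
    (hE (fun x y z => abs_mul_le_one (bB x z) (bC x y)) ?_)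
    (hE (fun x y z => abs_mul_le_one (abs_mul_le_one (bA y z) (bB x z)) (bC x y)) ?_) <;>
  · intro x y z
    simp only [sum_pm, hneg hA, hneg hB, hneg hC]
    ring
end

section
/- If a probability distribution P on ({-1,1})^3 is compatible with the Triangle scenario, then 0 ≤ 4 − 2⟨AB⟩ − 2⟨AC⟩ − 2⟨BC⟩ − ⟨ABC⟩ + 2⟨A⟩⟨B⟩ + 2⟨A⟩⟨C⟩ + 2⟨B⟩⟨C⟩ − ⟨A⟩⟨BC⟩ − ⟨B⟩⟨AC⟩ − ⟨C⟩⟨AB⟩, where ⟨·⟩ denotes the expectation under P of the indicated product of coordinates. -/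
open scoped BigOperators NNReal

/-- A real function which is affine and nonnegative at both endpoints of `[-1, 1]` is nonnegative
there. -/
lemma nonneg_of_affine_of_abs_le_one {t : ℝ} (ht : |t| ≤ 1) (F : ℝ → ℝ)
    (hF : ∀ s, F s = (F 1 + F (-1)) / 2 + (F 1 - F (-1)) / 2 * s)
    (h₁ : 0 ≤ F 1) (h₂ : 0 ≤ F (-1)) : 0 ≤ F t := by
  obtain ⟨hl, hr⟩ := abs_le.mp ht
  rw [hF]
  nlinarith [mul_nonneg h₁ (by linarith : 0 ≤ 1 + t), mul_nonneg h₂ (by linarith : 0 ≤ 1 - t)]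

/-- The pointwise inequality behind the spiral inflation of the Triangle scenario: `a, b, c` are the
first copies and `a', b', c'` the second copies of the observed variables. -/
lemma spiral_nonneg {a b c a' b' c' : ℝ} (ha : |a| ≤ 1) (hb : |b| ≤ 1) (hc : |c| ≤ 1)
    (ha' : |a'| ≤ 1) (hb' : |b'| ≤ 1) (hc' : |c'| ≤ 1) :
    0 ≤ (4 - a * b - a * c - b * c - a * b * c)
      + (a * c' + b' * c' - a * b' - a * b' * c')
      + (b * a' + c' * a' - b * c' - b * c' * a')
      + (c * b' + a' * b' - a' * c - a' * c * b') := by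
  refine nonneg_of_affine_of_abs_le_one ha (fun a => (4 - a * b - a * c - b * c - a * b * c)
      + (a * c' + b' * c' - a * b' - a * b' * c') + (b * a' + c' * a' - b * c' - b * c' * a')
      + (c * b' + a' * b' - a' * c - a' * c * b')) (fun s => by ring) ?_ ?_ <;>
  refine nonneg_of_affine_of_abs_le_one hb (fun b => (4 - _ * b - _ * c - b * c - _ * b * c)
      + (_ * c' + b' * c' - _ * b' - _ * b' * c') + (b * a' + c' * a' - b * c' - b * c' * a')
      + (c * b' + a' * b' - a' * c - a' * c * b')) (fun s => by ring) ?_ ?_ <;>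
  refine nonneg_of_affine_of_abs_le_one hc (fun c => (4 - _ * _ - _ * c - _ * c - _ * _ * c)
      + (_ * c' + b' * c' - _ * b' - _ * b' * c') + (_ * a' + c' * a' - _ * c' - _ * c' * a')
      + (c * b' + a' * b' - a' * c - a' * c * b')) (fun s => by ring) ?_ ?_ <;>
  refine nonneg_of_affine_of_abs_le_one ha' (fun a' => (4 - _ * _ - _ * _ - _ * _ - _ * _ * _)
      + (_ * c' + b' * c' - _ * b' - _ * b' * c') + (_ * a' + c' * a' - _ * c' - _ * c' * a')
      + (_ * b' + a' * b' - a' * _ - a' * _ * b')) (fun s => by ring) ?_ ?_ <;>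
  refine nonneg_of_affine_of_abs_le_one hb' (fun b' => (4 - _ * _ - _ * _ - _ * _ - _ * _ * _)
      + (_ * c' + b' * c' - _ * b' - _ * b' * c') + (_ * _ + c' * _ - _ * c' - _ * c' * _)
      + (_ * b' + _ * b' - _ * _ - _ * _ * b')) (fun s => by ring) ?_ ?_ <;>
  (obtain ⟨hl, hr⟩ := abs_le.mp hc'; norm_num; try linarith)

/-- The inequality for response functions with values in `[-1, 1]`: `w` is a product probability
weight on the latent variables, and the numbers `a, …, abc` are the correlators. -/
theorem spiral_expectation_nonneg {X Y Z : Type*} {u : X → ℝ} {v : Y → ℝ} {m : Z → ℝ}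
    {w : X × Y × Z → ℝ} (hw : ∀ x y z, w (x, y, z) = u x * v y * m z) (hw0 : ∀ t, 0 ≤ w t)
    (hw1 : HasSum w 1) {α : Y → Z → ℝ} {β : X → Z → ℝ} {γ : X → Y → ℝ}
    (hα : ∀ y z, |α y z| ≤ 1) (hβ : ∀ x z, |β x z| ≤ 1) (hγ : ∀ x y, |γ x y| ≤ 1)
    {a b c ab ac bc abc : ℝ}
    (ha : HasSum (fun t => w t * α t.2.1 t.2.2) a)
    (hb : HasSum (fun t => w t * β t.1 t.2.2) b)
    (hc : HasSum (fun t => w t * γ t.1 t.2.1) c)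
    (hab : HasSum (fun t => w t * (α t.2.1 t.2.2 * β t.1 t.2.2)) ab)
    (hac : HasSum (fun t => w t * (α t.2.1 t.2.2 * γ t.1 t.2.1)) ac)
    (hbc : HasSum (fun t => w t * (β t.1 t.2.2 * γ t.1 t.2.1)) bc)
    (habc : HasSum (fun t => w t * (α t.2.1 t.2.2 * β t.1 t.2.2 * γ t.1 t.2.1)) abc) :
    0 ≤ 4 - 2 * ab - 2 * ac - 2 * bc - abc + 2 * a * b + 2 * a * c + 2 * b * c
      - a * bc - b * ac - c * ab := by
  have prod {f g : X × Y × Z → ℝ} {p q : ℝ} (hf : HasSum (fun t => w t * f t) p)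
      (hg : HasSum (fun t => w t * g t) q) :
      HasSum (fun t : (X × Y × Z) × (X × Y × Z) => (w t.1 * f t.1) * (w t.2 * g t.2)) (p * q) :=
    hf.mul hg (summable_mul_of_summable_norm hf.summable.norm hg.summable.norm)
  have hone : HasSum (fun t => w t * (1 : ℝ)) 1 := by simpa using hw1
  let swapX : (X × Y × Z) × (X × Y × Z) ≃ (X × Y × Z) × (X × Y × Z) :=
    ⟨fun t => ((t.2.1, t.1.2.1, t.1.2.2), (t.1.1, t.2.2.1, t.2.2.2)),
      fun t => ((t.2.1, t.1.2.1, t.1.2.2), (t.1.1, t.2.2.1, t.2.2.2)), fun _ => rfl, fun _ => rfl⟩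
  let swapY : (X × Y × Z) × (X × Y × Z) ≃ (X × Y × Z) × (X × Y × Z) :=
    ⟨fun t => ((t.1.1, t.2.2.1, t.1.2.2), (t.2.1, t.1.2.1, t.2.2.2)),
      fun t => ((t.1.1, t.2.2.1, t.1.2.2), (t.2.1, t.1.2.1, t.2.2.2)), fun _ => rfl, fun _ => rfl⟩
  let swapZ : (X × Y × Z) × (X × Y × Z) ≃ (X × Y × Z) × (X × Y × Z) :=
    ⟨fun t => ((t.1.1, t.1.2.1, t.2.2.2), (t.2.1, t.2.2.1, t.1.2.2)),
      fun t => ((t.1.1, t.1.2.1, t.2.2.2), (t.2.1, t.2.2.1, t.1.2.2)), fun _ => rfl, fun _ => rfl⟩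
  have h₁ := (((((prod hone hone).mul_left 4).sub (prod hab hone)).sub (prod hac hone)).sub
    (prod hbc hone)).sub (prod habc hone)
  have hX := swapX.hasSum_iff.mpr
    ((((prod ha hc).add (prod hb hc)).sub (prod hab hone)).sub (prod hab hc))
  have hY := swapY.hasSum_iff.mpr
    ((((prod hb ha).add (prod hc ha)).sub (prod hbc hone)).sub (prod hbc ha))
  have hZ := swapZ.hasSum_iff.mpr
    ((((prod hc hb).add (prod ha hb)).sub (prod hac hone)).sub (prod hac hb))
  have key := (((h₁.add hX).add hY).add hZ).nonneg fun t => by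
    obtain ⟨⟨x, y, z⟩, ⟨x', y', z'⟩⟩ := t
    have h := mul_nonneg (mul_nonneg (hw0 (x, y, z)) (hw0 (x', y', z')))
      (spiral_nonneg (hα y z) (hβ x z) (hγ x y) (hα y z') (hβ x' z) (hγ x y'))
    simp only [swapX, swapY, swapZ, Equiv.coe_fn_mk, Function.comp_apply, hw] at h ⊢
    refine h.trans_eq ?_
    ring
  linarith

/-- Causal compatibility inequality (class of Eq. (27) of the paper) for the Triangle
scenario with binary `±1`-valued observed variables. -/
theorem triangle_inequality_class_four (P : ℝ → ℝ → ℝ → ℝ)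
    (hP0 : ∀ a ∈ pm, ∀ b ∈ pm, ∀ c ∈ pm, 0 ≤ P a b c)
    (hP1 : ∑ a ∈ pm, ∑ b ∈ pm, ∑ c ∈ pm, P a b c = 1)
    (hcomp : TriangleCompatible P) :
    0 ≤ 4 - 2 * corr (fun a b _ => a * b) P - 2 * corr (fun a _ c => a * c) P
      - 2 * corr (fun _ b c => b * c) P
      - corr (fun a b c => a * b * c) P
      + 2 * corr (fun a _ _ => a) P * corr (fun _ b _ => b) P
      + 2 * corr (fun a _ _ => a) P * corr (fun _ _ c => c) P
      + 2 * corr (fun _ b _ => b) P * corr (fun _ _ c => c) P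
      - corr (fun a _ _ => a) P * corr (fun _ b c => b * c) P
      - corr (fun _ b _ => b) P * corr (fun a _ c => a * c) P
      - corr (fun _ _ c => c) P * corr (fun a b _ => a * b) P := by
  obtain ⟨X, Y, Z, μX, μY, μZ, qA, qB, qC, hX, hY, hZ, hA, hB, hC, hP⟩ := hcomp
  have lift {T : Type} {μ : T → ℝ≥0} (h : ∑' t, μ t = 1) : HasSum (fun t => (μ t : ℝ)) 1 := by
    have hs : Summable μ := by
      by_contra hn
      simp [tsum_eq_zero_of_not_summable hn] at h
    exact NNReal.hasSum_coe.mpr (h ▸ hs.hasSum)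
  have mul {S T : Type} {f : S → ℝ} {g : T → ℝ} (hf : HasSum f 1) (hg : HasSum g 1) :
      HasSum (fun t : S × T => f t.1 * g t.2) 1 := by
    simpa using hf.mul hg (summable_mul_of_summable_norm hf.summable.norm hg.summable.norm)
  let w : X × Y × Z → ℝ := fun t => μX t.1 * (μY t.2.1 * μZ t.2.2)
  have hw1 : HasSum w 1 := mul (lift hX) (mul (lift hY) (lift hZ))
  have hw0 (t) : 0 ≤ w t := by positivity
  have hPsum {a b c : ℝ} (ha : a ∈ pm) (hb : b ∈ pm) (hc : c ∈ pm) :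
      HasSum (fun t => w t * ((qA t.2 a : ℝ) * qB (t.1, t.2.2) b * qC (t.1, t.2.1) c))
        (P a b c) := by
    have le_one {p q : ℝ≥0} (h : p + q = 1) : (p : ℝ) ≤ 1 ∧ (q : ℝ) ≤ 1 :=
      ⟨by exact_mod_cast h ▸ le_self_add, by exact_mod_cast h ▸ le_add_self⟩
    have hA1 (t) : (qA t a : ℝ) ≤ 1 := by
      rcases (by simpa [pm] using ha : a = -1 ∨ a = 1) with rfl | rfl
      exacts [(le_one (hA t)).1, (le_one (hA t)).2]
    have hB1 (t) : (qB t b : ℝ) ≤ 1 := by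
      rcases (by simpa [pm] using hb : b = -1 ∨ b = 1) with rfl | rfl
      exacts [(le_one (hB t)).1, (le_one (hB t)).2]
    have hC1 (t) : (qC t c : ℝ) ≤ 1 := by
      rcases (by simpa [pm] using hc : c = -1 ∨ c = 1) with rfl | rfl
      exacts [(le_one (hC t)).1, (le_one (hC t)).2]
    have hs : Summable
        (fun t => w t * ((qA t.2 a : ℝ) * qB (t.1, t.2.2) b * qC (t.1, t.2.1) c)) := by
      refine hw1.summable.of_nonneg_of_le (fun t => mul_nonneg (hw0 t) (by positivity)) fun t => ?_
      refine mul_le_of_le_one_right (hw0 t) (mul_le_one₀ (mul_le_one₀ (hA1 _) ?_ (hB1 _)) ?_ (hC1 _))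
        <;> positivity
    convert hs.hasSum using 1
    rw [hP, hs.tsum_prod]
    push_cast
    refine tsum_congr fun x => ?_
    rw [(hs.prod_factor x).tsum_prod]
    refine tsum_congr fun y => tsum_congr fun z => ?_
    simp only [w]
    ring
  have hcorr (f : ℝ → ℝ → ℝ → ℝ) : HasSum (fun t => w t * ∑ a ∈ pm, ∑ b ∈ pm, ∑ c ∈ pm,
      f a b c * ((qA t.2 a : ℝ) * qB (t.1, t.2.2) b * qC (t.1, t.2.1) c)) (corr f P) := by
    simp only [Finset.mul_sum]
    refine hasSum_sum fun a ha => hasSum_sum fun b hb => hasSum_sum fun c hc => ?_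
    simpa only [mul_left_comm] using (hPsum ha hb hc).mul_left (f a b c)
  have neg {p q : ℝ≥0} (h : p + q = 1) : (p : ℝ) = 1 - q := by
    rw [eq_sub_iff_add_eq]
    exact_mod_cast h
  have abs_le {p q : ℝ≥0} (h : p + q = 1) : |2 * (q : ℝ) - 1| ≤ 1 := by
    have := neg h
    rw [_root_.abs_le]
    constructor <;> linarith [p.coe_nonneg, q.coe_nonneg]
  refine spiral_expectation_nonneg (w := w) (u := fun x => μX x) (v := fun y => μY y)
    (m := fun z => μZ z) (α := fun y z => 2 * qA (y, z) 1 - 1)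
    (β := fun x z => 2 * qB (x, z) 1 - 1) (γ := fun x y => 2 * qC (x, y) 1 - 1)
    (fun x y z => (mul_assoc _ _ _).symm) hw0 hw1
    (fun y z => abs_le (hA _)) (fun x z => abs_le (hB _)) (fun x y => abs_le (hC _))
    ?_ ?_ ?_ ?_ ?_ ?_ ?_ <;>
  · convert hcorr _ using 2 with t
    have hne : (-1 : ℝ) ≠ 1 := by norm_num
    simp only [pm, Finset.sum_pair hne, neg (hA _), neg (hB _), neg (hC _)]
    ring
end

section
/- If a family of conditional distributions P(·,·|x,y) on ({0,1})^2, indexed by settings x,y ∈ {0,1}, is compatible with the Bell scenario, then the CHSH inequality E(0,0) + E(0,1) + E(1,0) − E(1,1) ≤ 2 holds, where E(x,y) := Σ_{a,b ∈ {0,1}} (−1)^{a+b} · P(a,b|x,y). -/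
open scoped BigOperators NNReal

/-- Compatibility of a family of conditional distributions `P a b x y = P(a,b|x,y)` on
`{0,1}²`, indexed by settings `x, y ∈ {0,1}`, with the Bell causal scenario: there is a
latent variable `Λ` with a probability mass function `μ` and local response functions
`pA`, `pB` reproducing `P`. -/
def BellCompatible (P : Fin 2 → Fin 2 → Fin 2 → Fin 2 → ℝ) : Prop :=
  ∃ (Λ : Type) (μ : Λ → ℝ≥0) (pA : Fin 2 × Λ → Fin 2 → ℝ≥0) (pB : Fin 2 × Λ → Fin 2 → ℝ≥0),
    (∑' l, μ l) = 1 ∧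
    (∀ xl, ∑ a, pA xl a = 1) ∧
    (∀ yl, ∑ b, pB yl b = 1) ∧
    ∀ a b x y, P a b x y = ((∑' l, μ l * pA (x, l) a * pB (y, l) b : ℝ≥0) : ℝ)

lemma chsh_le_two_of_abs_le_one {a₀ a₁ b₀ b₁ : ℝ} (ha₀ : |a₀| ≤ 1) (ha₁ : |a₁| ≤ 1)
    (hb₀ : |b₀| ≤ 1) (hb₁ : |b₁| ≤ 1) :
    a₀ * b₀ + a₀ * b₁ + a₁ * b₀ - a₁ * b₁ ≤ 2 := by
  have mul_le_abs : ∀ {a c : ℝ}, |a| ≤ 1 → a * c ≤ |c| := fun {a c} ha =>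
    calc a * c ≤ |a * c| := le_abs_self _
      _ = |a| * |c| := abs_mul a c
      _ ≤ |c| := mul_le_of_le_one_left (abs_nonneg c) ha
  have h₀ := mul_le_abs (c := b₀ + b₁) ha₀
  have h₁ := mul_le_abs (c := b₀ - b₁) ha₁
  have h : |b₀ + b₁| + |b₀ - b₁| ≤ 2 := by
    rw [abs_le] at hb₀ hb₁
    rcases abs_cases (b₀ + b₁) with h | h <;> rcases abs_cases (b₀ - b₁) with h' | h' <;> linarith
  linarith

/-- The expectation of the sign `(-1) ^ a` under a distribution on `Fin 2` lies in `[-1, 1]`. -/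
lemma abs_sub_le_one_of_sum_eq_one {p : Fin 2 → ℝ≥0} (hp : ∑ a, p a = 1) :
    |(p 0 : ℝ) - p 1| ≤ 1 := by
  rw [Fin.sum_univ_two] at hp
  have h : (p 0 : ℝ) + p 1 = 1 := by exact_mod_cast hp
  have h₀ := (p 0).coe_nonneg
  have h₁ := (p 1).coe_nonneg
  exact abs_le.mpr ⟨by linarith, by linarith⟩

/-- A sum weighted by a summable `μ` of products of probabilities converges. -/
lemma hasSum_mul_mul_of_sum_eq_one {Λ α β : Type*} [Fintype α] [Fintype β] {μ : Λ → ℝ≥0}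
    (hμ : Summable μ) {p : Λ → α → ℝ≥0} {q : Λ → β → ℝ≥0} (hp : ∀ l, ∑ a, p l a = 1)
    (hq : ∀ l, ∑ b, q l b = 1) (a : α) (b : β) :
    HasSum (fun l => (μ l * p l a * q l b : ℝ)) ((∑' l, μ l * p l a * q l b : ℝ≥0) : ℝ) := by
  have hle : ∀ l, μ l * p l a * q l b ≤ μ l := fun l => by
    have h₁ : p l a ≤ 1 :=
      (hp l) ▸ Finset.single_le_sum (fun _ _ => zero_le) (Finset.mem_univ a)
    have h₂ : q l b ≤ 1 :=
      (hq l) ▸ Finset.single_le_sum (fun _ _ => zero_le) (Finset.mem_univ b)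
    exact (mul_le_of_le_one_right zero_le h₂).trans (mul_le_of_le_one_right zero_le h₁)
  exact_mod_cast NNReal.hasSum_coe.mpr (NNReal.summable_of_le hle hμ).hasSum

/-- If a family of conditional distributions `P(·,·|x,y)` on `{0,1}²` is compatible with
the Bell scenario, then the CHSH inequality `E(0,0) + E(0,1) + E(1,0) − E(1,1) ≤ 2` holds,
where `E(x,y) = ∑_{a,b} (−1)^{a+b} P(a,b|x,y)`. -/
theorem chsh_inequality (P : Fin 2 → Fin 2 → Fin 2 → Fin 2 → ℝ)
    (hP0 : ∀ a b x y, 0 ≤ P a b x y)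
    (hP1 : ∀ x y, ∑ a, ∑ b, P a b x y = 1)
    (hcomp : BellCompatible P) :
    (∑ a : Fin 2, ∑ b : Fin 2, (-1 : ℝ) ^ ((a : ℕ) + (b : ℕ)) * P a b 0 0)
      + (∑ a : Fin 2, ∑ b : Fin 2, (-1 : ℝ) ^ ((a : ℕ) + (b : ℕ)) * P a b 0 1)
      + (∑ a : Fin 2, ∑ b : Fin 2, (-1 : ℝ) ^ ((a : ℕ) + (b : ℕ)) * P a b 1 0)
      - (∑ a : Fin 2, ∑ b : Fin 2, (-1 : ℝ) ^ ((a : ℕ) + (b : ℕ)) * P a b 1 1) ≤ 2 := by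
  obtain ⟨Λ, μ, pA, pB, hμ, hA, hB, hP⟩ := hcomp
  have hsμ : Summable μ := by
    by_contra h
    simp [tsum_eq_zero_of_not_summable h] at hμ
  have hμ₁ : HasSum (fun l => (μ l : ℝ)) 1 := by
    rw [← NNReal.coe_one, NNReal.hasSum_coe, ← hμ]
    exact hsμ.hasSum
  have hE : ∀ x y, HasSum
      (fun l => ∑ a : Fin 2, ∑ b : Fin 2,
        (-1 : ℝ) ^ ((a : ℕ) + (b : ℕ)) * (μ l * pA (x, l) a * pB (y, l) b))
      (∑ a : Fin 2, ∑ b : Fin 2, (-1 : ℝ) ^ ((a : ℕ) + (b : ℕ)) * P a b x y) := fun x y =>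
    hasSum_sum fun a _ => hasSum_sum fun b _ => by
      rw [hP]
      exact (hasSum_mul_mul_of_sum_eq_one hsμ (fun l => hA (x, l)) (fun l => hB (y, l))
        a b).mul_left _
  refine hasSum_le (fun l => ?_) ((((hE 0 0).add (hE 0 1)).add (hE 1 0)).sub (hE 1 1))
    (by simpa using hμ₁.mul_right 2)
  have h := mul_le_mul_of_nonneg_left
    (chsh_le_two_of_abs_le_one (abs_sub_le_one_of_sum_eq_one (hA (0, l)))
      (abs_sub_le_one_of_sum_eq_one (hA (1, l))) (abs_sub_le_one_of_sum_eq_one (hB (0, l)))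
      (abs_sub_le_one_of_sum_eq_one (hB (1, l)))) (μ l).coe_nonneg
  simp only [Fin.sum_univ_two, Fin.val_zero, Fin.val_one]
  convert h using 1
  ring
end

section
/- If a family of conditional distributions P(·,·|x,y) on ({0,1})^2, indexed by settings x,y ∈ {0,1}, is compatible with the Bell scenario, then the Hardy-type Bell inequality P(0,0|0,0) ≤ P(0,0|0,1) + P(0,0|1,0) + P(1,1|1,1) holds. -/
open scoped BigOperators NNReal

/-- Pointwise form of the Hardy-type inequality, for the local probabilities of outcome `0` at a
fixed value of the latent variable. -/
theorem hardy_pointwise {a₀ a₁ b₀ b₁ : ℝ} (ha₀ : 0 ≤ a₀) (ha₁ : 0 ≤ a₁) (hb₀ : 0 ≤ b₀)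
    (hb₁ : 0 ≤ b₁) (ha₀' : a₀ ≤ 1) (ha₁' : a₁ ≤ 1) (hb₀' : b₀ ≤ 1) (hb₁' : b₁ ≤ 1) :
    a₀ * b₀ ≤ a₀ * b₁ + a₁ * b₀ + (1 - a₁) * (1 - b₁) := by
  have h : 0 ≤ (1 - a₁) * (1 - b₁) :=
    mul_nonneg (sub_nonneg.2 ha₁') (sub_nonneg.2 hb₁')
  have h₁ : 0 ≤ (a₀ * b₀) * (a₁ * b₁) := by positivity
  have h₂ : 0 ≤ (a₀ * (1 - b₀)) * (b₁ + (1 - a₁) * (1 - b₁)) :=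
    mul_nonneg (mul_nonneg ha₀ (sub_nonneg.2 hb₀')) (add_nonneg hb₁ h)
  have h₃ : 0 ≤ ((1 - a₀) * b₀) * (a₁ + (1 - a₁) * (1 - b₁)) :=
    mul_nonneg (mul_nonneg (sub_nonneg.2 ha₀') hb₀) (add_nonneg ha₁ h)
  have h₄ : 0 ≤ ((1 - a₀) * (1 - b₀)) * ((1 - a₁) * (1 - b₁)) :=
    mul_nonneg (mul_nonneg (sub_nonneg.2 ha₀') (sub_nonneg.2 hb₀')) h
  linarith

/-- If a family of conditional distributions `P(·,·|x,y)` on `{0,1}²` is compatible with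
the Bell scenario, then the Hardy-type Bell inequality
`P(0,0|0,0) ≤ P(0,0|0,1) + P(0,0|1,0) + P(1,1|1,1)` holds. -/
theorem hardy_type_bell_inequality (P : Fin 2 → Fin 2 → Fin 2 → Fin 2 → ℝ)
    (hP0 : ∀ a b x y, 0 ≤ P a b x y)
    (hP1 : ∀ x y, ∑ a, ∑ b, P a b x y = 1)
    (hcomp : BellCompatible P) :
    P 0 0 0 0 ≤ P 0 0 0 1 + P 0 0 1 0 + P 1 1 1 1 := by
  obtain ⟨Λ, μ, pA, pB, hμ, hA, hB, hP⟩ := hcomp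
  have hμs : Summable μ := by
    by_contra h
    simp [tsum_eq_zero_of_not_summable h] at hμ
  have le_one {q : Fin 2 → ℝ≥0} (hq : ∑ i, q i = 1) (i : Fin 2) : q i ≤ 1 :=
    hq ▸ Finset.single_le_sum (fun _ _ => zero_le) (Finset.mem_univ i)
  have hs (a b x y : Fin 2) : Summable fun l => μ l * pA (x, l) a * pB (y, l) b := by
    refine NNReal.summable_of_le (fun l => ?_) hμs
    calc μ l * pA (x, l) a * pB (y, l) b ≤ μ l * 1 * 1 := by
          gcongr
          · exact le_one (hA _) a
          · exact le_one (hB _) b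
      _ = μ l := by ring
  simp only [hP]
  norm_cast
  rw [← (hs _ _ _ _).tsum_add (hs _ _ _ _),
    ← ((hs _ _ _ _).add (hs _ _ _ _)).tsum_add (hs _ _ _ _)]
  refine (hs _ _ _ _).tsum_le_tsum (fun l => ?_) (((hs _ _ _ _).add (hs _ _ _ _)).add (hs _ _ _ _))
  have complement {q : Fin 2 → ℝ≥0} (hq : ∑ i, q i = 1) : (q 1 : ℝ) = 1 - q 0 := by
    rw [Fin.sum_univ_two] at hq
    rw [eq_sub_iff_add_eq, add_comm]
    exact_mod_cast hq
  have h := hardy_pointwise (pA (0, l) 0).2 (pA (1, l) 0).2 (pB (0, l) 0).2 (pB (1, l) 0).2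
    (le_one (hA _) 0) (le_one (hA _) 0) (le_one (hB _) 0) (le_one (hB _) 0)
  rw [← NNReal.coe_le_coe]
  push_cast
  rw [complement (hA (1, l)), complement (hB (1, l))]
  have h' := mul_le_mul_of_nonneg_left h (μ l).2
  simp only [NNReal.val_eq_coe] at h'
  linarith
end

section
/- A family of conditional distributions P(·,·|x,y) on ({0,1})^2, indexed by settings x,y ∈ {0,1}, is compatible with the Bell scenario if and only if there exists a probability distribution Q on ({0,1})^4, with coordinates (a₀,a₁,b₀,b₁), such that for all a,b,x,y ∈ {0,1}: P(a,b|x,y) = Σ_{(a₀,a₁,b₀,b₁) : a_x = a and b_y = b} Q(a₀,a₁,b₀,b₁). -/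
open scoped BigOperators NNReal

/-- Summing a product of two distributions over the pairs whose `x`-th entry is `a` gives the
`x`-th marginal. -/
lemma sum_sum_ite_eq_marginal (p : Fin 2 → Fin 2 → ℝ≥0) (hp : ∀ x, ∑ a, p x a = 1)
    (x a : Fin 2) :
    (∑ a₀, ∑ a₁, if (if x = 0 then a₀ else a₁) = a then p 0 a₀ * p 1 a₁ else 0) = p x a := by
  match x with
  | 0 =>
    rw [Finset.sum_comm]
    simp [← Finset.mul_sum, hp]
  | 1 => simp [← Finset.sum_mul, hp]

/-- The product of marginals of two independent pairs as a sum over the joint distribution. -/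
lemma sum_ite_and_eq_mul_marginal (p q : Fin 2 → Fin 2 → ℝ≥0) (hp : ∀ x, ∑ a, p x a = 1)
    (hq : ∀ y, ∑ b, q y b = 1) (a b x y : Fin 2) :
    (∑ a₀, ∑ a₁, ∑ b₀, ∑ b₁,
      if (if x = 0 then a₀ else a₁) = a ∧ (if y = 0 then b₀ else b₁) = b
      then p 0 a₀ * p 1 a₁ * (q 0 b₀ * q 1 b₁) else 0) = p x a * q y b := by
  rw [← sum_sum_ite_eq_marginal p hp x a, ← sum_sum_ite_eq_marginal q hq y b]
  simp only [Finset.sum_mul]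
  simp only [Finset.mul_sum, ite_and, ite_mul, mul_ite, zero_mul, mul_zero]
  refine Finset.sum_congr rfl fun a₀ _ => Finset.sum_congr rfl fun a₁ _ =>
    Finset.sum_congr rfl fun b₀ _ => Finset.sum_congr rfl fun b₁ _ => ?_
  split_ifs <;> rfl

lemma le_one_of_sum_eq_one {ι : Type*} [Fintype ι] {p : ι → ℝ≥0} (hp : ∑ i, p i = 1) (i : ι) :
    p i ≤ 1 :=
  hp ▸ Finset.single_le_sum (fun _ _ => zero_le) (Finset.mem_univ i)

/-- Fine's theorem: a family of conditional distributions `P(·,·|x,y)` on `{0,1}²` is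
compatible with the Bell scenario if and only if there is a joint probability distribution
`Q` on quadruples `(a₀,a₁,b₀,b₁)` recovering each `P(a,b|x,y)` as the probability that
`a_x = a` and `b_y = b`. -/
theorem bell_compatible_iff_joint_distribution (P : Fin 2 → Fin 2 → Fin 2 → Fin 2 → ℝ)
    (hP0 : ∀ a b x y, 0 ≤ P a b x y)
    (hP1 : ∀ x y, ∑ a, ∑ b, P a b x y = 1) :
    BellCompatible P ↔
      ∃ Q : Fin 2 → Fin 2 → Fin 2 → Fin 2 → ℝ,
        (∀ a₀ a₁ b₀ b₁, 0 ≤ Q a₀ a₁ b₀ b₁) ∧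
        (∑ a₀, ∑ a₁, ∑ b₀, ∑ b₁, Q a₀ a₁ b₀ b₁ = 1) ∧
        ∀ a b x y, P a b x y =
          ∑ a₀, ∑ a₁, ∑ b₀, ∑ b₁,
            if (if x = 0 then a₀ else a₁) = a ∧ (if y = 0 then b₀ else b₁) = b
            then Q a₀ a₁ b₀ b₁ else 0 := by
  constructor
  · rintro ⟨Λ, μ, pA, pB, hμ, hA, hB, hP⟩
    have hμs : Summable μ := by
      by_contra h
      simp [tsum_eq_zero_of_not_summable h] at hμ
    let w : Fin 2 → Fin 2 → Fin 2 → Fin 2 → Λ → ℝ≥0 := fun a₀ a₁ b₀ b₁ l =>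
      μ l * (pA (0, l) a₀ * pA (1, l) a₁ * (pB (0, l) b₀ * pB (1, l) b₁))
    have hw (a₀ a₁ b₀ b₁ : Fin 2) : HasSum (w a₀ a₁ b₀ b₁) (∑' l, w a₀ a₁ b₀ b₁ l) := by
      refine (NNReal.summable_of_le (fun l => ?_) hμs).hasSum
      exact mul_le_of_le_one_right' (mul_le_one'
        (mul_le_one' (le_one_of_sum_eq_one (hA _) _) (le_one_of_sum_eq_one (hA _) _))
        (mul_le_one' (le_one_of_sum_eq_one (hB _) _) (le_one_of_sum_eq_one (hB _) _)))
    have hQ (a b x y : Fin 2) : P a b x y = ∑ a₀, ∑ a₁, ∑ b₀, ∑ b₁,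
        if (if x = 0 then a₀ else a₁) = a ∧ (if y = 0 then b₀ else b₁) = b
        then ((∑' l, w a₀ a₁ b₀ b₁ l : ℝ≥0) : ℝ) else 0 := by
      have key : HasSum (fun l => μ l * pA (x, l) a * pB (y, l) b)
          (∑ a₀, ∑ a₁, ∑ b₀, ∑ b₁,
            if (if x = 0 then a₀ else a₁) = a ∧ (if y = 0 then b₀ else b₁) = b
            then ∑' l, w a₀ a₁ b₀ b₁ l else 0) := by
        have h : ∀ l, μ l * pA (x, l) a * pB (y, l) b = ∑ a₀, ∑ a₁, ∑ b₀, ∑ b₁,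
            if (if x = 0 then a₀ else a₁) = a ∧ (if y = 0 then b₀ else b₁) = b
            then w a₀ a₁ b₀ b₁ l else 0 := fun l => by
          rw [mul_assoc, ← sum_ite_and_eq_mul_marginal (fun x => pA (x, l)) (fun y => pB (y, l))
            (fun _ => hA _) (fun _ => hB _)]
          simp only [Finset.mul_sum, mul_ite, mul_zero, w]
        simp only [h]
        refine hasSum_sum fun a₀ _ => hasSum_sum fun a₁ _ => hasSum_sum fun b₀ _ =>
          hasSum_sum fun b₁ _ => ?_
        by_cases hab : (if x = 0 then a₀ else a₁) = a ∧ (if y = 0 then b₀ else b₁) = b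
        · simpa only [if_pos hab] using hw a₀ a₁ b₀ b₁
        · simpa only [if_neg hab] using hasSum_zero
      rw [hP, key.tsum_eq]
      simp only [NNReal.coe_sum, apply_ite NNReal.toReal, NNReal.coe_zero]
    refine ⟨fun a₀ a₁ b₀ b₁ => ((∑' l, w a₀ a₁ b₀ b₁ l : ℝ≥0) : ℝ),
      fun _ _ _ _ => NNReal.coe_nonneg _, ?_, hQ⟩
    have h1 := hP1 0 0
    simp only [hQ, Fin.sum_univ_two] at h1
    simp [Fin.sum_univ_two] at h1 ⊢
    linarith
  · rintro ⟨Q, hQ0, hQ1, hQP⟩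
    refine ⟨Fin 2 × Fin 2 × Fin 2 × Fin 2,
      fun l => (Q l.1 l.2.1 l.2.2.1 l.2.2.2).toNNReal,
      fun xl a => if (if xl.1 = 0 then xl.2.1 else xl.2.2.1) = a then 1 else 0,
      fun yl b => if (if yl.1 = 0 then yl.2.2.2.1 else yl.2.2.2.2) = b then 1 else 0,
      ?_, fun _ => by simp, fun _ => by simp, fun a b x y => ?_⟩
    · rw [tsum_fintype, ← NNReal.coe_inj]
      simpa only [NNReal.coe_sum, Fintype.sum_prod_type, Real.coe_toNNReal _ (hQ0 _ _ _ _),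
        NNReal.coe_one] using hQ1
    · rw [hQP, tsum_fintype]
      simp only [NNReal.coe_sum, Fintype.sum_prod_type]
      refine Finset.sum_congr rfl fun a₀ _ => Finset.sum_congr rfl fun a₁ _ =>
        Finset.sum_congr rfl fun b₀ _ => Finset.sum_congr rfl fun b₁ _ => ?_
      rw [ite_and]
      by_cases ha : (if x = 0 then a₀ else a₁) = a <;>
        by_cases hb : (if y = 0 then b₀ else b₁) = b <;> simp [ha, hb, hQ0]
end

section
/- Copy Lemma: Let A, B, C be nonempty finite types and let p be a probability distribution on A × B × C. Then there exists a probability distribution q on A × A × B × C, with coordinates written (a, a', b, c), such that: (i) the marginal of q on (a,b,c) equals p; (ii) the marginal of q on (a',b) equals the marginal of p on (a,b); and (iii) the coordinate a' is conditionally independent of the pair (a,c) given b, i.e., for all a, a', b, c: q(a,a',b,c) · p_B(b) = p(a,b,c) · q_{A'B}(a',b), where p_B is the B-marginal of p and q_{A'B} is the (a',b)-marginal of q. -/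
open scoped BigOperators

/-- The Copy Lemma: for any probability distribution `p` on `A × B × C` (finite nonempty
types), there is a probability distribution `q` on `A × A × B × C`, with coordinates
`(a, a', b, c)`, whose `(a,b,c)`-marginal is `p`, whose `(a',b)`-marginal equals the
`(a,b)`-marginal of `p`, and in which `a'` is conditionally independent of `(a,c)` given
`b`. -/
theorem copy_lemma {A B C : Type*} [Fintype A] [Fintype B] [Fintype C]
    [Nonempty A] [Nonempty B] [Nonempty C]
    (p : A → B → C → ℝ) (hp0 : ∀ a b c, 0 ≤ p a b c)
    (hp1 : ∑ a, ∑ b, ∑ c, p a b c = 1) :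
    ∃ q : A → A → B → C → ℝ,
      (∀ a a' b c, 0 ≤ q a a' b c) ∧
      (∑ a, ∑ a', ∑ b, ∑ c, q a a' b c = 1) ∧
      (∀ a b c, ∑ a', q a a' b c = p a b c) ∧
      (∀ a' b, ∑ a, ∑ c, q a a' b c = ∑ c, p a' b c) ∧
      (∀ a a' b c,
        q a a' b c * (∑ a'', ∑ c', p a'' b c') =
          p a b c * (∑ a'', ∑ c', q a'' a' b c')) := by
  have hp_zero : ∀ a b c, ∑ a'', ∑ c', p a'' b c' = 0 → p a b c = 0 := by
    intro a b c h
    have ha := (Finset.sum_eq_zero_iff_of_nonneg fun a'' _ =>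
      Finset.sum_nonneg fun c' _ => hp0 a'' b c').1 h a (Finset.mem_univ a)
    exact (Finset.sum_eq_zero_iff_of_nonneg fun c' _ => hp0 a b c').1 ha c (Finset.mem_univ c)
  let q : A → A → B → C → ℝ := fun a a' b c =>
    p a b c * ((∑ c', p a' b c') / ∑ a'', ∑ c', p a'' b c')
  have hq_abc : ∀ a b c, ∑ a', q a a' b c = p a b c := by
    intro a b c
    simp only [q]
    rw [← Finset.mul_sum, ← Finset.sum_div]
    by_cases h : ∑ a'', ∑ c', p a'' b c' = 0
    · simp [hp_zero a b c h]
    · rw [div_self h, mul_one]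
  have hq_ab : ∀ a' b, ∑ a, ∑ c, q a a' b c = ∑ c, p a' b c := by
    intro a' b
    simp only [q, ← Finset.sum_mul]
    refine mul_div_cancel_of_imp' fun h => ?_
    exact Finset.sum_eq_zero fun c _ => hp_zero a' b c h
  refine ⟨q, fun a a' b c => ?_, ?_, hq_abc, hq_ab, fun a a' b c => ?_⟩
  · exact mul_nonneg (hp0 a b c) (div_nonneg (Finset.sum_nonneg fun c' _ => hp0 a' b c')
      (Finset.sum_nonneg fun a'' _ => Finset.sum_nonneg fun c' _ => hp0 a'' b c'))
  · rw [← hp1]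
    refine Finset.sum_congr rfl fun a _ => ?_
    rw [Finset.sum_comm]
    refine Finset.sum_congr rfl fun b _ => ?_
    rw [Finset.sum_comm]
    exact Finset.sum_congr rfl fun c _ => hq_abc a b c
  · rw [hq_ab]
    simp only [q]
    by_cases h : ∑ a'', ∑ c', p a'' b c' = 0
    · simp [hp_zero a b c h]
    · rw [mul_assoc, div_mul_cancel₀ _ h]
end
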